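/- Let d ≥ 3 be an integer and let p > d/(d-2). Then the linearized maximal operator T*₀ is bounded on l^p(ℤ^d): there exists a constant C = C(d,p) such that for all f ∈ l^p(ℤ^d), ‖T*₀(f)‖_{l^p(ℤ^d)} ≤ C ‖f‖_{l^p(ℤ^d)}. -/

import Mathlib

open scoped ENNReal NNReal BigOperators

noncomputable section

/-- `ℤ^d` -/
abbrev V (d : ℕ) := Fin d → ℤ

/-- The sphere `{(u,v) ∈ ℤ^d × ℤ^d : |u|² + |v|² = λ}`. -/
def sph (d lam : ℕ) : Set (V d × V d) :=
  {uv | (∑ i, uv.1 i ^ 2) + (∑ i, uv.2 i ^ 2) = (lam : ℤ)}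

/-- `N(λ)`, the number of lattice points on the sphere of radius `λ^{1/2}` in `ℝ^{2d}`. -/
def Ncount (d lam : ℕ) : ℕ := Nat.card (sph d lam)

/-- The bilinear discrete spherical average `T_λ(f,g)(x)`. -/
def avg (d lam : ℕ) (f g : V d → ℂ) (x : V d) : ℂ :=
  (Ncount d lam : ℂ)⁻¹ *
    ∑' uv : sph d lam, f (x - (uv : V d × V d).1) * g (x - (uv : V d × V d).2)

/-- The bilinear discrete spherical maximal function
`T*(f,g)(x) = sup_{λ ∈ ℕ, N(λ) > 0} |T_λ(f,g)(x)|`. -/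
def maxOp (d : ℕ) (f g : V d → ℂ) (x : V d) : ℝ≥0∞ :=
  ⨆ (lam : ℕ) (_ : 0 < Ncount d lam), (‖avg d lam f g x‖₊ : ℝ≥0∞)

/-- The `l^p(ℤ^d)` norm of a complex-valued function. -/
def lpNorm (d : ℕ) (p : ℝ) (f : V d → ℂ) : ℝ≥0∞ :=
  (∑' x : V d, (‖f x‖₊ : ℝ≥0∞) ^ p) ^ (1 / p)

/-- The `l^p(ℤ^d)` norm of an `ℝ≥0∞`-valued function. -/
def lpNormE (d : ℕ) (p : ℝ) (F : V d → ℝ≥0∞) : ℝ≥0∞ :=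
  (∑' x : V d, F x ^ p) ^ (1 / p)

/-- The `l^∞(ℤ^d)` norm. -/
def linftyNorm (d : ℕ) (f : V d → ℂ) : ℝ≥0∞ :=
  ⨆ x : V d, (‖f x‖₊ : ℝ≥0∞)


/-- The linearized average `T_{λ,0}(f)(x) = N(λ)⁻¹ Σ_{|u|²+|v|²=λ} f(x-u)`. -/
def avg0 (d lam : ℕ) (f : V d → ℂ) (x : V d) : ℂ :=
  (Ncount d lam : ℂ)⁻¹ * ∑' uv : sph d lam, f (x - (uv : V d × V d).1)

/-- The linearized maximal operator `T*₀(f)(x) = sup_{λ ∈ ℕ, N(λ)>0} |T_{λ,0}(f)(x)|`. -/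
def maxOp0 (d : ℕ) (f : V d → ℂ) (x : V d) : ℝ≥0∞ :=
  ⨆ (lam : ℕ) (_ : 0 < Ncount d lam), (‖avg0 d lam f x‖₊ : ℝ≥0∞)

/-- The nontrivial character modulo `4` as an arithmetic function. -/
def chiFun : ArithmeticFunction ℤ := ⟨fun n => ZMod.χ₄ (n : ZMod 4), by decide⟩

/-- The divisor sum of the nontrivial character modulo `4`. -/
def chiSum (n : ℕ) : ℤ := ∑ d ∈ n.divisors, ZMod.χ₄ (d : ZMod 4)

lemma chiSum_mul {m n : ℕ} (h : m.Coprime n) : chiSum (m * n) = chiSum m * chiSum n := by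
  have hm : chiFun.IsMultiplicative := by
    refine ⟨by simp [chiFun], ?_⟩
    intro m n _
    change ZMod.χ₄ ((m * n : ℕ) : ZMod 4) = ZMod.χ₄ (m : ZMod 4) * ZMod.χ₄ (n : ZMod 4)
    rw [Nat.cast_mul, map_mul]
  have hz : (chiFun * (ArithmeticFunction.zeta : ArithmeticFunction ℤ)).IsMultiplicative :=
    hm.mul ArithmeticFunction.isMultiplicative_zeta.natCast
  have := hz.2 h
  simpa only [ArithmeticFunction.coe_mul_zeta_apply] using! this

lemma chiSum_prime_pow {p : ℕ} (hp : p.Prime) (k : ℕ) :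
    chiSum (p ^ k) = ∑ i ∈ Finset.range (k + 1), ZMod.χ₄ (p : ZMod 4) ^ i := by
  simp only [chiSum, Nat.sum_divisors_prime_pow hp, Nat.cast_pow, map_pow]

/-- The Gaussian integers of norm `n`. -/
def circ (n : ℕ) : Set GaussianInt := {z | z.norm = n}

lemma circ_finite (n : ℕ) : (circ n).Finite := by
  have : (((Set.Icc (-(n:ℤ)) n) ×ˢ (Set.Icc (-(n:ℤ)) n))).Finite :=
    (Set.finite_Icc _ _).prod (Set.finite_Icc _ _)
  refine (this.image (fun z : ℤ × ℤ => (⟨z.1, z.2⟩ : GaussianInt))).subset ?_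
  rintro ⟨x, y⟩ h
  simp only [circ, Zsqrtd.norm_def, Set.mem_ofPred_eq] at h
  refine ⟨(x, y), ?_, rfl⟩
  simp only [Set.mem_prod, Set.mem_Icc]
  have := Int.le_self_sq x
  have := Int.le_self_sq (-x)
  have := Int.le_self_sq y
  have := Int.le_self_sq (-y)
  refine ⟨⟨?_, ?_⟩, ?_, ?_⟩ <;> nlinarith [sq_nonneg x, sq_nonneg y]

lemma circ_mul {m n : ℕ} {z w : GaussianInt} (hz : z ∈ circ m) (hw : w ∈ circ n) :
    z * w ∈ circ (m * n) := by
  simp only [circ, Set.mem_ofPred_eq] at *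
  rw [Zsqrtd.norm_mul, hz, hw]; push_cast; rfl

lemma circ_pow {m : ℕ} {z : GaussianInt} (hz : z ∈ circ m) (k : ℕ) : z ^ k ∈ circ (m ^ k) := by
  induction k with
  | zero => simp [circ]
  | succ k ih => rw [pow_succ, pow_succ]; exact circ_mul ih hz

lemma prime_of_norm_prime {p : ℕ} (hp : p.Prime) {z : GaussianInt} (hz : z ∈ circ p) :
    Prime z := by
  rw [← irreducible_iff_prime]
  simp only [circ, Set.mem_ofPred_eq] at hz
  refine ⟨fun hu => ?_, fun a b hab => ?_⟩
  · rw [← Zsqrtd.norm_eq_one_iff, hz] at hu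
    exact hp.one_lt.ne' (by simpa using hu)
  · rw [← Zsqrtd.norm_eq_one_iff, ← Zsqrtd.norm_eq_one_iff]
    have h : a.norm.natAbs * b.norm.natAbs = p := by
      rw [← Int.natAbs_mul, ← Zsqrtd.norm_mul, ← hab, hz]; simp
    rcases (Nat.dvd_prime hp).1 (Dvd.intro _ h) with h1 | h1
    · exact Or.inl h1
    · right
      rw [h1] at h
      exact Nat.eq_of_mul_eq_mul_left hp.pos (by simpa using h)

lemma prime_not_dvd_star {p : ℕ} (hp : p.Prime) (hodd : p % 2 = 1) {z : GaussianInt}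
    (hz : z ∈ circ p) : ¬ z ∣ star z := by
  intro h
  have h2 : z ∣ ((2 * z.re : ℤ) : GaussianInt) := by
    have : ((2 * z.re : ℤ) : GaussianInt) = z + star z := by
      ext <;> simp [two_mul]
    rw [this]; exact dvd_add dvd_rfl h
  have h3 : (p : ℤ) ∣ 2 * z.re * (2 * z.re) := by
    obtain ⟨w, hw⟩ := h2
    have := congrArg Zsqrtd.norm hw
    rw [Zsqrtd.norm_intCast, Zsqrtd.norm_mul, hz] at this
    exact ⟨_, this⟩
  have hpp : Prime (p : ℤ) := Nat.prime_iff_prime_int.1 hp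
  have hp2 : ¬ (p : ℤ) ∣ 2 := by
    intro h; have h1 := Int.le_of_dvd (by norm_num) h
    have := hp.two_le
    omega
  have hre : (p : ℤ) ∣ z.re := by
    have : (p : ℤ) ∣ 2 * z.re := (hpp.dvd_or_dvd h3).elim id id
    exact (hpp.dvd_or_dvd this).resolve_left hp2
  have hn : z.re * z.re + z.im * z.im = p := by
    have : z.norm = p := hz
    rw [Zsqrtd.norm_def] at this; linarith
  have him : (p : ℤ) ∣ z.im := by
    have : (p : ℤ) ∣ z.im * z.im := by
      rw [show z.im * z.im = p - z.re * z.re by linarith]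
      exact dvd_sub dvd_rfl (hre.mul_right _)
    exact (hpp.dvd_or_dvd this).elim id id
  have : (p : ℤ) * p ∣ p := by
    conv_rhs => rw [← hn]
    exact dvd_add (mul_dvd_mul hre hre) (mul_dvd_mul him him)
  have h5 := Int.le_of_dvd (by exact_mod_cast hp.pos) this
  have := hp.two_le
  nlinarith

lemma circ_mul_pow_aux {p : ℕ} (hp : p.Prime) (hodd : p % 2 = 1) {z : GaussianInt}
    (hz : z ∈ circ p) {b k : ℕ} (hb : ¬ p ∣ b) {j j' : ℕ} (hjk : j' ≤ k)
    (hjj : j < j') {w w' : GaussianInt} (hw : w ∈ circ b) :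
    z ^ j * star z ^ (k - j) * w ≠ z ^ j' * star z ^ (k - j') * w' := by
  have hzp := prime_of_norm_prime hp hz
  intro h
  have hs : star z ≠ 0 := by simpa using hzp.ne_zero
  have e1 : k - j = (k - j') + (j' - j) := by omega
  have e2 : j' = j + (j' - j) := by omega
  have h1 : z ^ j * star z ^ (k - j') * (star z ^ (j' - j) * w) =
      z ^ j * star z ^ (k - j') * (z ^ (j' - j) * w') := by
    calc _ = z ^ j * star z ^ (k - j) * w := by rw [e1, pow_add]; ring
      _ = z ^ j' * star z ^ (k - j') * w' := h
      _ = _ := by nth_rewrite 1 [e2]; rw [pow_add]; ring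
  have h2 := mul_left_cancel₀ (mul_ne_zero (pow_ne_zero _ hzp.ne_zero) (pow_ne_zero _ hs)) h1
  have h3 : z ∣ star z ^ (j' - j) * w := by
    rw [h2]; exact (dvd_pow_self z (by omega)).mul_right _
  rcases hzp.dvd_or_dvd h3 with h4 | h4
  · exact prime_not_dvd_star hp hodd hz (hzp.dvd_of_dvd_pow h4)
  · obtain ⟨v, rfl⟩ := h4
    apply hb
    have : (z * v).norm = b := hw
    rw [Zsqrtd.norm_mul, hz] at this
    exact_mod_cast Dvd.intro _ this

lemma circ_mul_pow {p : ℕ} (hp : p.Prime) (hodd : p % 2 = 1) {z : GaussianInt}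
    (hz : z ∈ circ p) {b : ℕ} (hb : ¬ p ∣ b) (k : ℕ) :
    (k + 1) * (circ b).ncard ≤ (circ (p ^ k * b)).ncard := by
  have hs : star z ∈ circ p := by
    simp only [circ, Set.mem_ofPred_eq] at *; rw [Zsqrtd.norm_conj, hz]
  have : ((Set.Iio (k + 1)) ×ˢ circ b).ncard ≤ (circ (p ^ k * b)).ncard := by
    refine Set.ncard_le_ncard_of_injOn
      (fun x : ℕ × GaussianInt => z ^ x.1 * star z ^ (k - x.1) * x.2) ?_ ?_ (circ_finite _)
    · rintro ⟨j, w⟩ ⟨hj, hw⟩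
      have hj' : j < k + 1 := hj
      have : p ^ k = p ^ j * p ^ (k - j) := by rw [← pow_add]; congr 1; omega
      rw [this]
      exact circ_mul (circ_mul (circ_pow hz _) (circ_pow hs _)) hw
    · rintro ⟨j, w⟩ ⟨hj, hw⟩ ⟨j', w'⟩ ⟨hj', hw'⟩ h
      have hj1 : j < k + 1 := hj
      have hj1' : j' < k + 1 := hj'
      simp only at h hw hw'
      rcases lt_trichotomy j j' with hl | rfl | hl
      · exact (circ_mul_pow_aux hp hodd hz hb (by omega) hl hw h).elim
      · have hzp := prime_of_norm_prime hp hz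
        have hs : star z ≠ 0 := by simpa using hzp.ne_zero
        rw [mul_left_cancel₀ (mul_ne_zero (pow_ne_zero _ hzp.ne_zero) (pow_ne_zero _ hs)) h]
      · exact (circ_mul_pow_aux hp hodd hz hb (by omega) hl hw' h.symm).elim
  rw [Set.ncard_prod] at this
  simpa using this

lemma circ_mul_sq (b c : ℕ) (hc : c ≠ 0) : (circ b).ncard ≤ (circ (c ^ 2 * b)).ncard := by
  refine Set.ncard_le_ncard_of_injOn (fun x => (c : GaussianInt) * x) ?_ ?_ (circ_finite _)
  · intro w hw
    refine circ_mul ?_ hw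
    simp [circ, sq]
  · intro w _ w' _ h
    exact mul_left_cancel₀ (by exact_mod_cast hc) h

lemma chiSum_le_circ (n : ℕ) (hn : n % 2 = 1) :
    0 ≤ chiSum n ∧ 2 * chiSum n ≤ (circ n).ncard := by
  induction n using Nat.strong_induction_on with
  | _ n ih =>
  by_cases h1 : n = 1
  · subst h1
    have : ({1, -1} : Set GaussianInt).ncard ≤ (circ 1).ncard := by
      refine Set.ncard_le_ncard ?_ (circ_finite _)
      rintro x (rfl | rfl) <;> simp [circ]
    rw [Set.ncard_pair (by decide)] at this
    simp only [chiSum, Nat.divisors_one, Finset.sum_singleton, Nat.cast_one, map_one]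
    exact ⟨zero_le_one, by exact_mod_cast this⟩
  set p := n.minFac with hpdef
  have hp : p.Prime := Nat.minFac_prime h1
  have hpn : p ∣ n := n.minFac_dvd
  have hn0 : n ≠ 0 := by omega
  obtain ⟨k, b, hb, hnk⟩ := Nat.exists_eq_pow_mul_and_not_dvd hn0 p hp.ne_one
  have hpodd : p % 2 = 1 := by
    obtain ⟨c, hc⟩ := hpn
    rw [hc] at hn
    rcases Nat.mod_two_eq_zero_or_one p with h | h
    · rw [Nat.mul_mod, h] at hn; simp at hn
    · exact h
  have hk : k ≠ 0 := by
    rintro rfl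
    apply hb; simpa [hnk] using hpn
  have hb0 : 0 < b := Nat.pos_of_ne_zero (by rintro rfl; simp at hb)
  have hbodd : b % 2 = 1 := by
    rw [hnk] at hn
    rcases Nat.mod_two_eq_zero_or_one b with h | h
    · rw [Nat.mul_mod, h] at hn; simp at hn
    · exact h
  have hlt : b < n := by
    rw [hnk]
    have : 2 ≤ p ^ k := hp.two_le.trans (Nat.le_self_pow hk p)
    nlinarith
  obtain ⟨ihb0, ihb⟩ := ih b hlt hbodd
  have hcop : (p ^ k).Coprime b := Nat.Coprime.pow_left _ ((Nat.Prime.coprime_iff_not_dvd hp).2 hb)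
  rw [hnk, chiSum_mul hcop, chiSum_prime_pow hp]
  rcases Nat.odd_mod_four_iff.1 hpodd with h | h
  · rw [ZMod.χ₄_nat_one_mod_four h]
    have : Fact p.Prime := ⟨hp⟩
    obtain ⟨x, y, hxy⟩ := Nat.Prime.sq_add_sq (p := p) (by omega)
    have hz : (⟨x, y⟩ : GaussianInt) ∈ circ p := by
      simp only [circ, Set.mem_ofPred_eq, Zsqrtd.norm_def]
      rw [← hxy]; push_cast; ring
    have := circ_mul_pow hp hpodd hz hb k
    have h' : ((k : ℤ) + 1) * (circ b).ncard ≤ (circ (p ^ k * b)).ncard := by exact_mod_cast this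
    simp only [one_pow, Finset.sum_const, Finset.card_range, nsmul_eq_mul, mul_one]
    push_cast
    exact ⟨by positivity, by nlinarith⟩
  · rw [ZMod.χ₄_nat_three_mod_four h, neg_one_geom_sum]
    split_ifs with he
    · simp
    · have : Even k := by
        rw [Nat.even_add_one, not_not] at he; exact he
      obtain ⟨l, rfl⟩ := this
      have := circ_mul_sq b (p ^ l) (pow_ne_zero _ hp.ne_zero)
      rw [← pow_mul, mul_two] at this
      have h' : ((circ b).ncard : ℤ) ≤ (circ (p ^ (l + l) * b)).ncard := by exact_mod_cast this
      rw [one_mul]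
      exact ⟨ihb0, by linarith⟩

/-- The odd solutions `((a, b), (c, d))` of `a b + c d = 2 m`. -/
def quads (m : ℕ) : Finset ((ℕ × ℕ) × (ℕ × ℕ)) :=
  ((Finset.range (2 * m + 1) ×ˢ Finset.range (2 * m + 1)) ×ˢ
    (Finset.range (2 * m + 1) ×ˢ Finset.range (2 * m + 1))).filter fun q =>
      q.1.1 % 2 = 1 ∧ q.1.2 % 2 = 1 ∧ q.2.1 % 2 = 1 ∧ q.2.2 % 2 = 1 ∧
        q.1.1 * q.1.2 + q.2.1 * q.2.2 = 2 * m

lemma mem_quads {m a b c d : ℕ} : ((a, b), (c, d)) ∈ quads m ↔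
    a % 2 = 1 ∧ b % 2 = 1 ∧ c % 2 = 1 ∧ d % 2 = 1 ∧ a * b + c * d = 2 * m := by
  simp only [quads, Finset.mem_filter, Finset.mem_product, Finset.mem_range, and_iff_right_iff_imp]
  rintro ⟨ha, hb, hc, hd, h⟩
  have := Nat.le_mul_of_pos_right a (show 0 < b by omega)
  have := Nat.le_mul_of_pos_left b (show 0 < a by omega)
  have := Nat.le_mul_of_pos_right c (show 0 < d by omega)
  have := Nat.le_mul_of_pos_left d (show 0 < c by omega)
  omega

/-- The sign with which a solution counts in a product of two divisor sums. -/
def quadSign (q : (ℕ × ℕ) × (ℕ × ℕ)) : ℤ :=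
  ZMod.χ₄ (q.1.1 : ZMod 4) * ZMod.χ₄ (q.2.1 : ZMod 4)

/-- The involution of Dirichlet cancelling the solutions with `a > c` in pairs. -/
def dirichletFlip (q : (ℕ × ℕ) × (ℕ × ℕ)) : (ℕ × ℕ) × (ℕ × ℕ) :=
  let s := q.1.1 - q.2.1
  let t := q.1.2 + q.2.2
  let e := q.1.2 + q.2.1 / s * t
  ((e + t, q.2.1 % s), (e, s - q.2.1 % s))

lemma dirichletFlip_eq {s th r b d : ℕ} (hr : r < s) :
    dirichletFlip ((s * th + r + s, b), (s * th + r, d)) =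
      ((b + th * (b + d) + (b + d), r), (b + th * (b + d), s - r)) := by
  have h1 : (s * th + r) / s = th := by
    rw [Nat.mul_add_div (by omega), Nat.div_eq_of_lt hr, add_zero]
  have h2 : (s * th + r) % s = r := by
    rw [Nat.mul_add_mod, Nat.mod_eq_of_lt hr]
  simp [dirichletFlip, h1, h2]

lemma chi_cancel : ∀ a b c d e : ZMod 4,
    (2 * a = 2 ∧ 2 * b = 2 ∧ 2 * c = 2 ∧ 2 * d = 2 ∧ 2 * e = 2 ∧ a * b + c * d = 2) →
    ZMod.χ₄ a * ZMod.χ₄ c + ZMod.χ₄ (e + (b + d)) * ZMod.χ₄ e = 0 := by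
  decide

lemma two_mul_cast_zmod {a : ℕ} (h : a % 2 = 1) : 2 * (a : ZMod 4) = 2 := by
  have : ((2 * a : ℕ) : ZMod 4) = ((2 : ℕ) : ZMod 4) := by
    rw [ZMod.natCast_eq_natCast_iff, Nat.ModEq]; omega
  exact_mod_cast this

lemma quadSign_sum_gt {m : ℕ} (hm : m % 2 = 1) :
    ∑ q ∈ (quads m).filter (fun q => q.2.1 < q.1.1), quadSign q = 0 := by
  have key : ∀ q ∈ (quads m).filter (fun q => q.2.1 < q.1.1),
      quadSign q + quadSign (dirichletFlip q) = 0 ∧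
      dirichletFlip q ∈ (quads m).filter (fun q => q.2.1 < q.1.1) ∧
      dirichletFlip (dirichletFlip q) = q := by
    rintro ⟨⟨a, b⟩, ⟨c, d⟩⟩ hq
    rw [Finset.mem_filter, mem_quads] at hq
    obtain ⟨⟨ha, hb, hc, hd, h⟩, hlt⟩ := hq
    simp only at hlt
    obtain ⟨s, th, r, hr, rfl, rfl⟩ : ∃ s th r, r < s ∧ c = s * th + r ∧ a = s * th + r + s := by
      refine ⟨a - c, c / (a - c), c % (a - c), Nat.mod_lt _ (by omega), ?_, ?_⟩
      · exact (Nat.div_add_mod _ _).symm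
      · rw [Nat.div_add_mod]; omega
    rw [dirichletFlip_eq hr]
    have hs : s % 2 = 0 := by omega
    have hsm : s * th % 2 = 0 := by rw [Nat.mul_mod, hs]; simp
    have htm : th * (b + d) % 2 = 0 := by
      rw [Nat.mul_mod, show (b + d) % 2 = 0 by omega]; simp
    have hro : r % 2 = 1 := by omega
    obtain ⟨u, rfl⟩ := Nat.exists_eq_add_of_lt hr
    refine ⟨?_, ?_, ?_⟩
    · have := chi_cancel ((((r + u + 1) * th + r + (r + u + 1) : ℕ)) : ZMod 4) (b : ZMod 4)
        ((((r + u + 1) * th + r : ℕ)) : ZMod 4) (d : ZMod 4) ((b + th * (b + d) : ℕ) : ZMod 4)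
        ⟨two_mul_cast_zmod ha, two_mul_cast_zmod hb, two_mul_cast_zmod hc,
        two_mul_cast_zmod hd, two_mul_cast_zmod (by omega), by
          have : ((2 * m : ℕ) : ZMod 4) = ((2 : ℕ) : ZMod 4) := by
            rw [ZMod.natCast_eq_natCast_iff, Nat.ModEq]; omega
          rw [← h] at this
          exact_mod_cast this⟩
      rw [← this]
      simp only [quadSign]
      congr 2
      push_cast; rfl
    · rw [Finset.mem_filter, mem_quads]
      refine ⟨⟨by omega, hro, by omega, by omega, ?_⟩, by simp only; omega⟩
      rw [show r + u + 1 - r = u + 1 by omega, ← h]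
      ring
    · have e := dirichletFlip_eq (s := b + d) (th := th) (r := b) (b := r) (d := u + 1)
        (by omega)
      have e1 : b + th * (b + d) + (b + d) = (b + d) * th + b + (b + d) := by ring
      have e2 : b + th * (b + d) = (b + d) * th + b := by ring
      rw [show r + u + 1 - r = u + 1 by omega, e1, e2, e, show b + d - b = d by omega]
      ext <;> simp <;> ring
  refine Finset.sum_involution (fun q _ => dirichletFlip q) (fun q hq => (key q hq).1) ?_
    (fun q hq => (key q hq).2.1) (fun q hq => (key q hq).2.2)
  intro q hq hne heq
  have := (key q hq).1
  rw [heq] at this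
  omega

lemma quadSign_sum {m : ℕ} (hm : m % 2 = 1) : (m : ℤ) ≤ ∑ q ∈ quads m, quadSign q := by
  have hlt : ∑ q ∈ (quads m).filter (fun q => q.1.1 < q.2.1), quadSign q = 0 := by
    rw [← quadSign_sum_gt hm]
    refine Finset.sum_nbij' Prod.swap Prod.swap ?_ ?_ (fun _ _ => rfl) (fun _ _ => rfl) ?_
    · rintro ⟨⟨a, b⟩, ⟨c, d⟩⟩ h
      simp only [Finset.mem_filter, mem_quads, Prod.swap] at h ⊢
      refine ⟨⟨?_, ?_, ?_, ?_, ?_⟩, ?_⟩ <;> omega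
    · rintro ⟨⟨a, b⟩, ⟨c, d⟩⟩ h
      simp only [Finset.mem_filter, mem_quads, Prod.swap] at h ⊢
      refine ⟨⟨?_, ?_, ?_, ?_, ?_⟩, ?_⟩ <;> omega
    · rintro ⟨⟨a, b⟩, ⟨c, d⟩⟩ _
      simp [quadSign, mul_comm]
  have hdiag : (m : ℤ) ≤ ∑ q ∈ (quads m).filter (fun q => q.1.1 = q.2.1), quadSign q := by
    have h1 : ∀ q ∈ (quads m).filter (fun q => q.1.1 = q.2.1), quadSign q = 1 := by
      rintro ⟨⟨a, b⟩, ⟨c, d⟩⟩ h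
      rw [Finset.mem_filter, mem_quads] at h
      obtain ⟨⟨ha, -⟩, h⟩ := h
      simp only at h
      subst h
      have : ∀ a : ZMod 4, 2 * a = 2 → ZMod.χ₄ a * ZMod.χ₄ a = 1 := by decide
      exact this _ (two_mul_cast_zmod ha)
    rw [Finset.sum_congr rfl h1, Finset.sum_const, nsmul_eq_mul, mul_one]
    have : (Finset.range m).card ≤ ((quads m).filter (fun q => q.1.1 = q.2.1)).card := by
      refine Finset.card_le_card_of_injOn
        (fun i => ((1, 2 * i + 1), (1, 2 * m - (2 * i + 1)))) ?_ ?_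
      · intro i hi
        simp only [Finset.coe_range, Set.mem_Iio] at hi
        rw [Finset.mem_coe, Finset.mem_filter, mem_quads]
        refine ⟨⟨rfl, by omega, rfl, by omega, ?_⟩, rfl⟩
        rw [one_mul, one_mul]
        omega
      · intro i _ j _ h
        simp only [Prod.mk.injEq] at h
        omega
    rw [Finset.card_range] at this
    exact_mod_cast this
  rw [← Finset.sum_filter_add_sum_filter_not _ (fun q => q.1.1 < q.2.1), hlt, zero_add,
    ← Finset.sum_filter_add_sum_filter_not _ (fun q => q.2.1 < q.1.1), Finset.filter_filter,
    Finset.filter_filter]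
  have e1 : (quads m).filter (fun q => ¬ q.1.1 < q.2.1 ∧ q.2.1 < q.1.1) =
      (quads m).filter (fun q => q.2.1 < q.1.1) :=
    Finset.filter_congr (fun q _ => by omega)
  have e2 : (quads m).filter (fun q => ¬ q.1.1 < q.2.1 ∧ ¬ q.2.1 < q.1.1) =
      (quads m).filter (fun q => q.1.1 = q.2.1) :=
    Finset.filter_congr (fun q _ => by omega)
  rw [e1, e2, quadSign_sum_gt hm, zero_add]
  exact hdiag

lemma chiSum_eq (n : ℕ) : chiSum n = ∑ x ∈ n.divisorsAntidiagonal, ZMod.χ₄ (x.1 : ZMod 4) := by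
  rw [chiSum, Nat.sum_divisorsAntidiagonal (f := fun i _ => ZMod.χ₄ (i : ZMod 4))]

/-- The decompositions of `2 m` into two summands, the first one odd. -/
def oddPairs (m : ℕ) : Finset (ℕ × ℕ) :=
  (Finset.HasAntidiagonal.antidiagonal (2 * m)).filter fun x => x.1 % 2 = 1

lemma le_sum_chiSum_mul {m : ℕ} (hm : m % 2 = 1) :
    (m : ℤ) ≤ ∑ x ∈ oddPairs m, chiSum x.1 * chiSum x.2 := by
  refine (quadSign_sum hm).trans_eq ?_
  have hmaps : ∀ q ∈ quads m, ((q.1.1 * q.1.2, q.2.1 * q.2.2) : ℕ × ℕ) ∈ oddPairs m := by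
    rintro ⟨⟨a, b⟩, ⟨c, d⟩⟩ h
    rw [mem_quads] at h
    simp only [oddPairs, Finset.mem_filter, Finset.HasAntidiagonal.mem_antidiagonal]
    exact ⟨h.2.2.2.2, by rw [Nat.mul_mod, h.1, h.2.1]⟩
  rw [← Finset.sum_fiberwise_of_maps_to hmaps]
  refine Finset.sum_congr rfl ?_
  rintro ⟨u, v⟩ huv
  simp only [oddPairs, Finset.mem_filter, Finset.HasAntidiagonal.mem_antidiagonal] at huv
  rw [chiSum_eq, chiSum_eq, Finset.sum_mul_sum, ← Finset.sum_product']
  refine Finset.sum_congr ?_ (fun _ _ => rfl)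
  ext ⟨⟨a, b⟩, ⟨c, d⟩⟩
  simp only [Finset.mem_filter, mem_quads, Finset.mem_product, Nat.mem_divisorsAntidiagonal,
    Prod.mk.injEq]
  have hodd : ∀ x y : ℕ, x * y % 2 = 1 → x % 2 = 1 ∧ y % 2 = 1 := by
    intro x y h
    rw [← Nat.odd_iff, Nat.odd_mul, Nat.odd_iff, Nat.odd_iff] at h
    exact h
  constructor
  · rintro ⟨h, rfl, rfl⟩
    exact ⟨⟨rfl, by omega⟩, rfl, by omega⟩
  · rintro ⟨⟨rfl, -⟩, rfl, -⟩
    have h1 := hodd _ _ huv.2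
    have h2 := hodd c d (by omega)
    exact ⟨⟨h1.1, h1.2, h2.1, h2.2, huv.1⟩, rfl, rfl⟩

/-- The number of representations of `n` as a sum of `k` squares. -/
def rep : ℕ → ℤ → ℕ
  | 0, n => if n = 0 then 1 else 0
  | k + 1, n => ∑ j ∈ Finset.Icc (-n) n, rep k (n - j ^ 2)

lemma rep_neg (k : ℕ) {n : ℤ} (hn : n < 0) : rep k n = 0 := by
  cases k with
  | zero => simp [rep, hn.ne]
  | succ k => rw [rep, Finset.Icc_eq_empty (by omega), Finset.sum_empty]

lemma rep_succ (k : ℕ) {n : ℤ} (W : Finset ℤ) (hW : ∀ j : ℤ, j ^ 2 ≤ n → j ∈ W) :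
    rep (k + 1) n = ∑ j ∈ W, rep k (n - j ^ 2) := by
  have h : ∀ W' : Finset ℤ, (∀ j : ℤ, j ^ 2 ≤ n → j ∈ W') →
      ∑ j ∈ W', rep k (n - j ^ 2) = ∑ j ∈ W' ∪ W, rep k (n - j ^ 2) := by
    intro W' hW'
    refine Finset.sum_subset Finset.subset_union_left ?_
    intro j _ hj
    refine rep_neg k ?_
    by_contra! hc
    exact hj (hW' j (by linarith))
  rw [rep, h (Finset.Icc (-n) n), Finset.union_comm, ← Finset.union_self W]
  · rw [Finset.union_self]
    refine (Finset.sum_subset Finset.subset_union_left ?_).symm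
    intro j _ hj
    refine rep_neg k ?_
    by_contra! hc
    exact hj (hW j (by linarith))
  · intro j hj
    rw [Finset.mem_Icc]
    have := Int.le_self_sq j
    have := Int.le_self_sq (-j)
    constructor <;> nlinarith

lemma rep_succ_Icc (k : ℕ) {n N : ℤ} (hN : 0 ≤ N) (hn : n ≤ N ^ 2) :
    rep (k + 1) n = ∑ j ∈ Finset.Icc (-N) N, rep k (n - j ^ 2) := by
  refine rep_succ k _ fun j hj => ?_
  rw [Finset.mem_Icc, ← abs_le]
  exact abs_le_of_sq_le_sq (hj.trans hn) hN

lemma tsum_fin_succ {k : ℕ} (g : (Fin (k + 1) → ℤ) → ℝ≥0∞) :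
    ∑' v, g v = ∑' j : ℤ, ∑' w : Fin k → ℤ, g (Fin.cons j w) := by
  rw [← (Fin.consEquiv (fun _ : Fin (k + 1) => ℤ)).tsum_eq g, ENNReal.tsum_prod']
  rfl

lemma tsum_rep (k l : ℕ) (n : ℤ) :
    ∑' v : Fin k → ℤ, (rep l (n - ∑ i, v i ^ 2) : ℝ≥0∞) = rep (k + l) n := by
  induction k generalizing n with
  | zero => simp
  | succ k ih =>
    rw [tsum_fin_succ, show k + 1 + l = (k + l) + 1 by ring,
      rep_succ (k + l) (n := n) (Finset.Icc (-n) n)]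
    · simp_rw [Fin.sum_univ_succ, Fin.cons_zero, Fin.cons_succ, ← sub_sub, ih]
      rw [tsum_eq_sum (s := Finset.Icc (-n) n)]
      · push_cast; rfl
      · intro j hj
        rw [rep_neg, Nat.cast_zero]
        by_contra! hc
        apply hj
        rw [Finset.mem_Icc]
        have := Int.le_self_sq j
        have := Int.le_self_sq (-j)
        constructor <;> nlinarith
    · intro j hj
      rw [Finset.mem_Icc]
      have := Int.le_self_sq j
      have := Int.le_self_sq (-j)
      constructor <;> nlinarith

lemma tsum_sphere (k : ℕ) (n : ℤ) :
    ∑' v : Fin k → ℤ, (if ∑ i, v i ^ 2 = n then (1 : ℝ≥0∞) else 0) = rep k n := by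
  rw [← show ∑' v : Fin k → ℤ, (rep 0 (n - ∑ i, v i ^ 2) : ℝ≥0∞) = rep k n from tsum_rep k 0 n]
  refine tsum_congr fun v => ?_
  by_cases h : ∑ i, v i ^ 2 = n
  · simp [h, rep]
  · have h' : n - ∑ i, v i ^ 2 ≠ 0 := fun h' => h (by linarith)
    rw [rep, if_neg h, if_neg h', Nat.cast_zero]

lemma card_le_rep {k : ℕ} {n : ℤ} (T : Finset (Fin k → ℤ)) (hT : ∀ v ∈ T, ∑ i, v i ^ 2 = n) :
    T.card ≤ rep k n := by
  have h : ∑ v ∈ T, (if ∑ i, v i ^ 2 = n then (1 : ℝ≥0∞) else 0) ≤ rep k n := by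
    rw [← tsum_sphere]; exact ENNReal.sum_le_tsum T
  rw [Finset.sum_congr rfl (fun v hv => if_pos (hT v hv))] at h
  simpa using h

/-- The Gaussian integers of norm `n` with odd real part. -/
def oddCirc (n : ℕ) : Finset GaussianInt := (circ_finite n).toFinset.filter fun z => z.re % 2 = 1

lemma mem_oddCirc {n : ℕ} {z : GaussianInt} :
    z ∈ oddCirc n ↔ z.re ^ 2 + z.im ^ 2 = n ∧ z.re % 2 = 1 := by
  simp only [oddCirc, Finset.mem_filter, Set.Finite.mem_toFinset, circ, Set.mem_ofPred_eq,
    Zsqrtd.norm_def]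
  rw [show z.re * z.re - -1 * z.im * z.im = z.re ^ 2 + z.im ^ 2 by ring]

lemma sq_mod_two (x : ℤ) : x ^ 2 % 2 = x % 2 := by
  rcases Int.emod_two_eq_zero_or_one x with h | h <;> simp [sq, Int.mul_emod, h]

lemma chiSum_le_oddCirc (n : ℕ) (hn : n % 2 = 1) : chiSum n ≤ (oddCirc n).card := by
  have h1 := (chiSum_le_circ n hn).2
  have h2 : (circ n).ncard ≤ (oddCirc n).card + (oddCirc n).card := by
    rw [Set.ncard_eq_toFinset_card _ (circ_finite n),
      ← Finset.card_filter_add_card_filter_not (fun z : GaussianInt => z.re % 2 = 1)]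
    refine Nat.add_le_add le_rfl ?_
    refine Finset.card_le_card_of_injOn (fun z => ⟨z.im, z.re⟩) ?_ ?_
    · intro z hz
      simp only [Finset.coe_filter, Set.Finite.mem_toFinset, Set.mem_ofPred_eq, circ,
        Zsqrtd.norm_def] at hz
      rw [Finset.mem_coe, mem_oddCirc]
      have e : z.im ^ 2 + z.re ^ 2 = n := by linarith [hz.1]
      have := sq_mod_two z.im
      have := sq_mod_two z.re
      exact ⟨e, by simp only; omega⟩
    · intro z _ w _ h
      simp only [Zsqrtd.mk.injEq] at h
      exact Zsqrtd.ext h.2 h.1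
  have h3 : ((circ n).ncard : ℤ) ≤ (oddCirc n).card + (oddCirc n).card := by exact_mod_cast h2
  linarith

lemma le_rep_four {m : ℕ} (hm : m % 2 = 1) : m ≤ rep 4 m := by
  have h1 : (m : ℤ) ≤ ∑ x ∈ oddPairs m, ((oddCirc x.1 ×ˢ oddCirc x.2).card : ℤ) := by
    refine (le_sum_chiSum_mul hm).trans (Finset.sum_le_sum fun x hx => ?_)
    simp only [oddPairs, Finset.mem_filter, Finset.HasAntidiagonal.mem_antidiagonal] at hx
    rw [Finset.card_product, Nat.cast_mul]
    exact mul_le_mul (chiSum_le_oddCirc _ hx.2) (chiSum_le_oddCirc _ (by omega))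
      (chiSum_le_circ _ (by omega)).1 (Nat.cast_nonneg _)
  have h2 : (m : ℤ) ≤ ((oddPairs m).sigma fun x => oddCirc x.1 ×ˢ oddCirc x.2).card := by
    rw [Finset.card_sigma]; exact_mod_cast h1
  have h3 : m ≤ ((oddPairs m).sigma fun x => oddCirc x.1 ×ˢ oddCirc x.2).card := by
    exact_mod_cast h2
  refine h3.trans ?_
  set F : (Σ _ : ℕ × ℕ, GaussianInt × GaussianInt) → (Fin 4 → ℤ) := fun q =>
    ![(q.2.1.re + q.2.2.re) / 2, (q.2.1.re - q.2.2.re) / 2, (q.2.1.im + q.2.2.im) / 2,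
      (q.2.1.im - q.2.2.im) / 2] with hF
  have hmem : ∀ q ∈ (oddPairs m).sigma fun x => oddCirc x.1 ×ˢ oddCirc x.2,
      q.2.1.re ^ 2 + q.2.1.im ^ 2 = q.1.1 ∧ q.2.2.re ^ 2 + q.2.2.im ^ 2 = q.1.2 ∧
      q.2.1.re % 2 = 1 ∧ q.2.2.re % 2 = 1 ∧ q.2.1.im % 2 = 0 ∧ q.2.2.im % 2 = 0 ∧
      (q.1.1 + q.1.2 : ℤ) = 2 * m := by
    rintro ⟨⟨a, b⟩, ⟨z, w⟩⟩ hq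
    simp only [oddPairs, Finset.mem_sigma, Finset.mem_filter,
      Finset.HasAntidiagonal.mem_antidiagonal, Finset.mem_product, mem_oddCirc] at hq ⊢
    have := sq_mod_two z.im
    have := sq_mod_two z.re
    have := sq_mod_two w.im
    have := sq_mod_two w.re
    refine ⟨hq.2.1.1, hq.2.2.1, hq.2.1.2, hq.2.2.2, by omega, by omega, by omega⟩
  rw [← Finset.card_image_of_injOn (f := F)]
  · refine card_le_rep _ fun v hv => ?_
    obtain ⟨q, hq, rfl⟩ := Finset.mem_image.1 hv
    obtain ⟨e1, e2, o1, o2, o3, o4, e3⟩ := hmem q hq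
    simp only [hF, Fin.sum_univ_four]
    simp only [Matrix.cons_val]
    obtain ⟨x, hx⟩ : ∃ x, q.2.1.re + q.2.2.re = 2 * x := ⟨_, (Int.mul_ediv_cancel' (by omega)).symm⟩
    obtain ⟨y, hy⟩ : ∃ x, q.2.1.re - q.2.2.re = 2 * x := ⟨_, (Int.mul_ediv_cancel' (by omega)).symm⟩
    obtain ⟨z, hz⟩ : ∃ x, q.2.1.im + q.2.2.im = 2 * x := ⟨_, (Int.mul_ediv_cancel' (by omega)).symm⟩
    obtain ⟨w, hw⟩ : ∃ x, q.2.1.im - q.2.2.im = 2 * x := ⟨_, (Int.mul_ediv_cancel' (by omega)).symm⟩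
    have r1 : q.2.1.re = x + y := by linarith
    have r2 : q.2.2.re = x - y := by linarith
    have r3 : q.2.1.im = z + w := by linarith
    have r4 : q.2.2.im = z - w := by linarith
    rw [hx, hy, hz, hw]
    simp only [ne_eq, OfNat.ofNat_ne_zero, not_false_eq_true, Int.mul_ediv_cancel_left]
    rw [r1, r3] at e1
    rw [r2, r4] at e2
    linarith
  · rintro q hq q' hq' h
    obtain ⟨e1, e2, o1, o2, o3, o4, e3⟩ := hmem q hq
    obtain ⟨e1', e2', o1', o2', o3', o4', e3'⟩ := hmem q' hq'
    have i0 := congrFun h 0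
    have i1 := congrFun h 1
    have i2 := congrFun h 2
    have i3 := congrFun h 3
    simp only [hF, Matrix.cons_val] at i0 i1 i2 i3
    have r1 : q.2.1 = q'.2.1 := Zsqrtd.ext (by omega) (by omega)
    have r2 : q.2.2 = q'.2.2 := Zsqrtd.ext (by omega) (by omega)
    rw [r1] at e1
    rw [r2] at e2
    obtain ⟨⟨a, b⟩, ⟨z, w⟩⟩ := q
    obtain ⟨⟨a', b'⟩, ⟨z', w'⟩⟩ := q'
    simp only at r1 r2 e1 e2 e1' e2'
    subst r1 r2
    have : a = a' := by omega
    have : b = b' := by omega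
    subst a b
    rfl

lemma sum_rep_le {k : ℕ} {n : ℤ} (T : Finset ℕ) (g : ℕ → ℕ) (hg : Function.Injective g) :
    ∑ i ∈ T, rep k (n - (g i : ℤ) ^ 2) ≤ rep (k + 1) n := by
  classical
  have hinj : Function.Injective fun i : ℕ => ((g i : ℕ) : ℤ) :=
    fun a b h => hg (Nat.cast_injective h)
  rw [rep_succ k (Finset.Icc (-n) n ∪ T.image fun i => ((g i : ℕ) : ℤ)) (n := n)]
  · rw [← Finset.sum_image (f := fun j : ℤ => rep k (n - j ^ 2)) (g := fun i => ((g i : ℕ) : ℤ))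
      fun a _ b _ h => hinj h]
    exact Finset.sum_le_sum_of_subset Finset.subset_union_right
  · intro j hj
    refine Finset.mem_union_left _ ?_
    have := Int.le_self_sq j
    have := Int.le_self_sq (-j)
    rw [Finset.mem_Icc]
    constructor <;> nlinarith

lemma le_rep_five {n : ℕ} (hn : 1 ≤ n) : 1 / 12 * √(n : ℝ) ^ 3 ≤ rep 5 n := by
  rcases hn.eq_or_lt with rfl | hn
  · have h1 := sum_rep_le (k := 4) (n := 1) {0} id Function.injective_id
    have h2 := le_rep_four (m := 1) rfl
    simp only [Finset.sum_singleton, id, Nat.cast_zero, Nat.cast_one] at h1 h2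
    norm_num at h1 ⊢
    have : (1 : ℝ) ≤ rep 5 1 := by exact_mod_cast h2.trans h1
    linarith
  set s := Nat.sqrt (n / 2) with hs
  have hs1 : 1 ≤ s := Nat.le_sqrt.2 (by omega)
  have hs2 : s * s ≤ n / 2 := Nat.sqrt_le _
  have hs3 : n / 2 < (s + 1) * (s + 1) := Nat.lt_succ_sqrt _
  set t := (s + 1) / 2 with ht
  have key : t * n ≤ 2 * rep 5 n := by
    have h1 := sum_rep_le (k := 4) (n := n) (Finset.range t) (fun i => 2 * i + (n + 1) % 2)
      (fun a b h => by simpa using h)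
    have h2 : ∀ i ∈ Finset.range t,
        n ≤ 2 * rep 4 ((n : ℤ) - ((2 * i + (n + 1) % 2 : ℕ) : ℤ) ^ 2) := by
      intro i hi
      rw [Finset.mem_range] at hi
      set j := 2 * i + (n + 1) % 2 with hj
      have hjs : j ≤ s := by omega
      have hjj : j ^ 2 ≤ n / 2 := by nlinarith
      have hodd : j ^ 2 % 2 = (n + 1) % 2 := by
        rw [Nat.pow_mod]
        have : j % 2 = (n + 1) % 2 := by omega
        rw [this]
        rcases Nat.mod_two_eq_zero_or_one (n + 1) with h | h <;> simp [h]
      have h3 := le_rep_four (m := n - j ^ 2) (by omega)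
      rw [Nat.cast_sub (by omega), Nat.cast_pow] at h3
      omega
    have h3 := Finset.sum_le_sum h2
    rw [← Finset.mul_sum] at h3
    simp only [Finset.sum_const, Finset.card_range, smul_eq_mul] at h3
    exact h3.trans (Nat.mul_le_mul_left 2 h1)
  have hsq : √(n : ℝ) ^ 2 = n := Real.sq_sqrt (Nat.cast_nonneg n)
  have ht6 : √(n : ℝ) / 6 ≤ t := by
    have h1 : (s : ℝ) ≤ 2 * t := by
      have : s ≤ 2 * t := by omega
      exact_mod_cast this
    have h2 : √(n : ℝ) ≤ 3 * s := by
      rw [Real.sqrt_le_left (by positivity)]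
      have : n ≤ (3 * s) ^ 2 := by
        have : n < 2 * ((s + 1) * (s + 1)) := by omega
        nlinarith
      exact_mod_cast this
    linarith
  have key' : (t : ℝ) * n ≤ 2 * rep 5 n := by exact_mod_cast key
  have : √(n : ℝ) / 6 * √(n : ℝ) ^ 2 ≤ t * n := by
    rw [hsq]; gcongr
  linarith [show √(n : ℝ) ^ 3 = √(n : ℝ) * √(n : ℝ) ^ 2 by ring]

lemma exists_le_rep (e : ℕ) :
    ∃ c : ℝ, 0 < c ∧ ∀ n : ℕ, 1 ≤ n → c * √(n : ℝ) ^ (e + 3) ≤ rep (e + 5) n := by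
  induction e with
  | zero => exact ⟨1 / 12, by norm_num, fun n hn => le_rep_five hn⟩
  | succ e ih =>
    obtain ⟨c, hc, h⟩ := ih
    refine ⟨c / √2 ^ (e + 4), by positivity, fun n hn => ?_⟩
    set s := Nat.sqrt (n / 2) with hs
    have hs2 : s * s ≤ n / 2 := Nat.sqrt_le _
    have hs3 : n / 2 < (s + 1) * (s + 1) := Nat.lt_succ_sqrt _
    have hhalf : √((n : ℝ) / 2) ≤ s + 1 := by
      rw [Real.sqrt_le_left (by positivity), div_le_iff₀ (by norm_num)]
      have : n ≤ (s + 1) ^ 2 * 2 := by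
        have : n < 2 * ((s + 1) * (s + 1)) := by omega
        nlinarith
      exact_mod_cast this
    have h1 := sum_rep_le (k := e + 5) (n := n) (Finset.range (s + 1)) id Function.injective_id
    have h2 : ∀ j ∈ Finset.range (s + 1),
        c * √((n : ℝ) / 2) ^ (e + 3) ≤ rep (e + 5) ((n : ℤ) - ((id j : ℕ) : ℤ) ^ 2) := by
      intro j hj
      rw [Finset.mem_range] at hj
      have hjj : j ^ 2 ≤ n / 2 := by nlinarith
      have h3 := h (n - j ^ 2) (by omega)
      have h4 : (n : ℝ) / 2 ≤ ((n - j ^ 2 : ℕ) : ℝ) := by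
        rw [div_le_iff₀ (by norm_num)]
        have : n ≤ (n - j ^ 2) * 2 := by omega
        exact_mod_cast this
      have h5 : ((n - j ^ 2 : ℕ) : ℤ) = (n : ℤ) - (j : ℤ) ^ 2 := by
        rw [Nat.cast_sub (by omega), Nat.cast_pow]
      rw [h5] at h3
      refine le_trans ?_ h3
      gcongr
    have h3 := Finset.sum_le_sum h2
    rw [Finset.sum_const, Finset.card_range, nsmul_eq_mul] at h3
    have h4 : ((∑ j ∈ Finset.range (s + 1), rep (e + 5) ((n : ℤ) - ((id j : ℕ) : ℤ) ^ 2) : ℕ) : ℝ)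
        ≤ rep (e + 5 + 1) n := by exact_mod_cast h1
    push_cast at h3 h4
    calc c / √2 ^ (e + 4) * √(n : ℝ) ^ (e + 1 + 3)
        = √((n : ℝ) / 2) * (c * √((n : ℝ) / 2) ^ (e + 3)) := by
          rw [Real.sqrt_div (Nat.cast_nonneg n)]
          have : √(2 : ℝ) ≠ 0 := by positivity
          rw [show e + 1 + 3 = (e + 3) + 1 by ring, show e + 4 = (e + 3) + 1 by ring, div_pow,
            pow_succ, pow_succ]
          generalize e + 3 = k
          field_simp
          ring
      _ ≤ (s + 1) * (c * √((n : ℝ) / 2) ^ (e + 3)) := by gcongr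
      _ ≤ _ := h3.trans h4

/-- The quadratic exponential sum over `|k| ≤ N` at frequency `a / P`. -/
def gauss (P : ℕ) [NeZero P] (N : ℤ) (a : ZMod P) : ℂ :=
  ∑ k ∈ Finset.Icc (-N) N, ZMod.stdAddChar (a * (k : ZMod P) ^ 2)

/-- The number of representations of a residue as a sum of squares of integers in `[-N, N]`. -/
def modRep (P : ℕ) (N : ℤ) : ℕ → ZMod P → ℕ
  | 0, m => if m = 0 then 1 else 0
  | k + 1, m => ∑ j ∈ Finset.Icc (-N) N, modRep P N k (m - (j : ZMod P) ^ 2)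

lemma rep_le_modRep (P : ℕ) {N : ℤ} (hN : 0 ≤ N) (k : ℕ) {n : ℤ} (hn : n ≤ N ^ 2) :
    rep k n ≤ modRep P N k n := by
  induction k generalizing n with
  | zero =>
    simp only [rep, modRep]
    split_ifs with h h' <;> simp_all
  | succ k ih =>
    rw [rep_succ_Icc k hN hn, modRep]
    refine Finset.sum_le_sum fun j _ => ?_
    have := ih (n := n - j ^ 2) (by nlinarith [sq_nonneg j])
    push_cast at this
    exact this

lemma mul_modRep (P : ℕ) [NeZero P] (N : ℤ) (k : ℕ) (m : ZMod P) :
    (P : ℂ) * modRep P N k m = ∑ a, gauss P N a ^ k * ZMod.stdAddChar (-(a * m)) := by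
  induction k generalizing m with
  | zero =>
    have h := AddChar.sum_mulShift (-m) (ZMod.isPrimitive_stdAddChar P)
    simp only [mul_neg, neg_eq_zero, ZMod.card] at h
    simp only [pow_zero, one_mul, modRep, h]
    split_ifs <;> simp
  | succ k ih =>
    rw [modRep]
    push_cast
    rw [Finset.mul_sum, Finset.sum_congr rfl fun j _ => ih _, Finset.sum_comm]
    refine Finset.sum_congr rfl fun a _ => ?_
    rw [pow_succ, gauss, mul_assoc, Finset.sum_mul, Finset.mul_sum]
    refine Finset.sum_congr rfl fun j _ => ?_
    rw [← AddChar.map_add_eq_mul]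
    congr 2
    ring

lemma norm_stdAddChar (P : ℕ) [NeZero P] (a : ZMod P) : ‖(ZMod.stdAddChar a : ℂ)‖ = 1 := by
  rw [ZMod.stdAddChar_apply, Circle.norm_coe]

lemma mul_modRep_le (P : ℕ) [NeZero P] (N : ℤ) (k : ℕ) (m : ZMod P) :
    (P : ℝ) * modRep P N k m ≤ ∑ a, ‖gauss P N a‖ ^ k := by
  have h := congrArg norm (mul_modRep P N k m)
  rw [norm_mul, Complex.norm_natCast, Complex.norm_natCast] at h
  rw [h]
  refine (norm_sum_le _ _).trans (Finset.sum_le_sum fun a _ => ?_)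
  rw [norm_mul, norm_stdAddChar, mul_one, norm_pow]

lemma mul_three_le {x y z : ℝ} (hx : 0 ≤ x) (hy : 0 ≤ y) (hz : 0 ≤ z) :
    x ^ 2 * y ^ 2 * z ^ 2 ≤ ((x * y) ^ 3 + (y * z) ^ 3 + (z * x) ^ 3) / 3 := by
  have key : ∀ a b c : ℝ, 0 ≤ a → 0 ≤ b → 0 ≤ c → a * b * c ≤ (a ^ 3 + b ^ 3 + c ^ 3) / 3 := by
    intro a b c ha hb hc
    nlinarith [mul_nonneg (add_nonneg (add_nonneg ha hb) hc)
      (add_nonneg (add_nonneg (sq_nonneg (a - b)) (sq_nonneg (b - c))) (sq_nonneg (c - a)))]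
  calc x ^ 2 * y ^ 2 * z ^ 2 = (x * y) * (y * z) * (z * x) := by ring
    _ ≤ _ := key _ _ _ (by positivity) (by positivity) (by positivity)

/-- The third moment of a Fourier transform, bounded by Young's inequality. -/
lemma sum_modRep_cube_le (P : ℕ) [NeZero P] (N : ℤ) (k : ℕ) :
    (P : ℝ) ^ 2 * ∑ m, (modRep P N k m : ℝ) ^ 3 ≤ (∑ a, √‖gauss P N a‖ ^ (3 * k)) ^ 2 := by
  set F : ZMod P → ℂ := fun a => gauss P N a ^ k with hF
  set w : ZMod P → ℝ := fun a => √‖gauss P N a‖ ^ k with hw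
  have hw0 : ∀ a, 0 ≤ w a := fun a => by positivity
  have hFw : ∀ a, ‖F a‖ = w a ^ 2 := fun a => by
    simp only [hF, hw]
    rw [norm_pow, ← pow_mul, mul_comm, pow_mul, Real.sq_sqrt (norm_nonneg _)]
  have hexp : (P : ℂ) ^ 3 * ∑ m, (modRep P N k m : ℂ) ^ 3
      = P * ∑ a, ∑ b, F a * F b * F (-a - b) := by
    calc (P : ℂ) ^ 3 * ∑ m, (modRep P N k m : ℂ) ^ 3
        = ∑ m, (∑ a, F a * ZMod.stdAddChar (-(a * m))) ^ 3 := by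
          rw [Finset.mul_sum]
          exact Finset.sum_congr rfl fun m _ => by rw [← mul_pow, mul_modRep]
      _ = ∑ m, ∑ a, ∑ b, ∑ c, F a * F b * F c * ZMod.stdAddChar (m * (-a - b - c)) := by
          refine Finset.sum_congr rfl fun m _ => ?_
          rw [pow_succ, sq, Finset.sum_mul_sum, Finset.sum_mul]
          refine Finset.sum_congr rfl fun a _ => ?_
          rw [Finset.sum_mul]
          refine Finset.sum_congr rfl fun b _ => ?_
          rw [Finset.mul_sum]
          refine Finset.sum_congr rfl fun c _ => ?_
          rw [show m * (-a - b - c) = -(a * m) + -(b * m) + -(c * m) by ring,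
            AddChar.map_add_eq_mul, AddChar.map_add_eq_mul]
          ring
      _ = ∑ a, ∑ b, ∑ c, F a * F b * F c * ∑ m, ZMod.stdAddChar (m * (-a - b - c)) := by
          rw [Finset.sum_comm]
          refine Finset.sum_congr rfl fun a _ => ?_
          rw [Finset.sum_comm]
          refine Finset.sum_congr rfl fun b _ => ?_
          rw [Finset.sum_comm]
          refine Finset.sum_congr rfl fun c _ => ?_
          rw [Finset.mul_sum]
      _ = _ := by
          rw [Finset.mul_sum]
          refine Finset.sum_congr rfl fun a _ => ?_
          rw [Finset.mul_sum]
          refine Finset.sum_congr rfl fun b _ => ?_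
          rw [Finset.sum_eq_single (-a - b)]
          · rw [AddChar.sum_mulShift _ (ZMod.isPrimitive_stdAddChar P), if_pos (by ring), ZMod.card]
            ring
          · intro c _ hc
            rw [AddChar.sum_mulShift _ (ZMod.isPrimitive_stdAddChar P),
              if_neg (fun h => hc (sub_eq_zero.1 h).symm), Nat.cast_zero, mul_zero]
          · simp
  have hP : (0 : ℝ) < P := Nat.cast_pos.2 (NeZero.pos P)
  have hnorm : (P : ℝ) ^ 3 * ∑ m, (modRep P N k m : ℝ) ^ 3
      ≤ P * ∑ a, ∑ b, w a ^ 2 * w b ^ 2 * w (-a - b) ^ 2 := by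
    have h := congrArg norm hexp
    rw [norm_mul, norm_mul, norm_pow, Complex.norm_natCast,
      show (∑ m, (modRep P N k m : ℂ) ^ 3) = ((∑ m, modRep P N k m ^ 3 : ℕ) : ℂ) by push_cast; rfl,
      Complex.norm_natCast] at h
    push_cast at h
    rw [h]
    gcongr
    refine (norm_sum_le _ _).trans (Finset.sum_le_sum fun a _ => ?_)
    refine (norm_sum_le _ _).trans (Finset.sum_le_sum fun b _ => ?_)
    rw [norm_mul, norm_mul, hFw, hFw, hFw]
  have hbound : ∑ a, ∑ b, w a ^ 2 * w b ^ 2 * w (-a - b) ^ 2 ≤ (∑ a, w a ^ 3) ^ 2 := by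
    have h1 : ∑ a, ∑ b, (w a * w b) ^ 3 = (∑ a, w a ^ 3) ^ 2 := by
      rw [sq, Finset.sum_mul_sum]
      simp only [mul_pow]
    have h2 : ∀ a : ZMod P, ∑ b, w (-a - b) ^ 3 = ∑ b, w b ^ 3 := fun a =>
      Equiv.sum_comp (Equiv.subLeft (-a)) fun b => w b ^ 3
    have h3 : ∑ a, ∑ b, (w b * w (-a - b)) ^ 3 = (∑ a, w a ^ 3) ^ 2 := by
      rw [Finset.sum_comm, sq, Finset.sum_mul]
      refine Finset.sum_congr rfl fun b _ => ?_
      simp only [mul_pow]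
      rw [← Finset.mul_sum, ← h2 b]
      simp only [sub_eq_add_neg, add_comm]
    have h4 : ∑ a, ∑ b, (w (-a - b) * w a) ^ 3 = (∑ a, w a ^ 3) ^ 2 := by
      rw [sq, Finset.mul_sum]
      refine Finset.sum_congr rfl fun a _ => ?_
      simp only [mul_pow]
      rw [← Finset.sum_mul, h2]
    calc ∑ a, ∑ b, w a ^ 2 * w b ^ 2 * w (-a - b) ^ 2
        ≤ ∑ a, ∑ b, ((w a * w b) ^ 3 + (w b * w (-a - b)) ^ 3 + (w (-a - b) * w a) ^ 3) / 3 :=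
          Finset.sum_le_sum fun a _ => Finset.sum_le_sum fun b _ =>
            mul_three_le (hw0 _) (hw0 _) (hw0 _)
      _ = _ := by
          simp only [← Finset.sum_div, Finset.sum_add_distrib]
          rw [h1, h3, h4]
          ring
  have hw3 : ∑ a, w a ^ 3 = ∑ a, √‖gauss P N a‖ ^ (3 * k) := by
    simp only [hw, ← pow_mul, mul_comm]
  rw [← hw3]
  refine le_of_mul_le_mul_left ?_ hP
  calc (P : ℝ) * (P ^ 2 * ∑ m, (modRep P N k m : ℝ) ^ 3)
      = P ^ 3 * ∑ m, (modRep P N k m : ℝ) ^ 3 := by ring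
    _ ≤ _ := hnorm.trans (by gcongr)

/-- The additive character `e(x) = exp(2πix)` of the real line. -/
def ee (x : ℝ) : ℂ := Complex.exp (Complex.I * ((2 * Real.pi * x : ℝ) : ℂ))

lemma ee_add (x y : ℝ) : ee (x + y) = ee x * ee y := by
  rw [ee, ee, ee, ← Complex.exp_add]
  congr 1
  push_cast
  ring

lemma ee_intCast (n : ℤ) : ee n = 1 := by
  rw [ee, Complex.exp_eq_one_iff]
  exact ⟨n, by push_cast; ring⟩

lemma norm_ee (x : ℝ) : ‖ee x‖ = 1 := by
  rw [ee, mul_comm, Complex.norm_exp_ofReal_mul_I]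

lemma conj_ee (x : ℝ) : (starRingEnd ℂ) (ee x) = ee (-x) := by
  rw [ee, ee, ← Complex.exp_conj, map_mul, Complex.conj_I, Complex.conj_ofReal]
  congr 1
  push_cast
  ring

lemma ee_sub_intCast (x : ℝ) (n : ℤ) : ee (x - n) = ee x := by
  have h := ee_add (x - n) n
  rw [ee_intCast, mul_one, sub_add_cancel] at h
  exact h.symm

lemma norm_ee_sub_one_le (x : ℝ) : ‖ee x - 1‖ ≤ 7 * |x| := by
  refine (Real.norm_exp_I_mul_ofReal_sub_one_le).trans ?_
  rw [Real.norm_eq_abs, abs_mul, abs_of_pos (by positivity : (0 : ℝ) < 2 * Real.pi)]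
  gcongr
  linarith [Real.pi_lt_d2]

lemma le_norm_ee_sub_one {x : ℝ} (hx : |x| ≤ 1 / 2) : 4 * |x| ≤ ‖ee x - 1‖ := by
  have hpi := Real.pi_pos
  rw [ee, Complex.norm_exp_I_mul_ofReal_sub_one, norm_mul, Real.norm_eq_abs, Real.norm_eq_abs,
    show 2 * Real.pi * x / 2 = Real.pi * x by ring, abs_of_pos (by norm_num : (0 : ℝ) < 2)]
  have h := Real.mul_abs_le_abs_sin (x := Real.pi * x)
    (by rw [abs_mul, abs_of_pos hpi]; nlinarith)
  rw [abs_mul, abs_of_pos hpi, show 2 / Real.pi * (Real.pi * |x|) = 2 * |x| by field_simp] at h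
  linarith

lemma norm_sum_ee_mul_le (γ : ℝ) (u v : ℤ) :
    ‖∑ l ∈ Finset.Icc u v, ee (γ * l)‖ * ‖ee γ - 1‖ ≤ 2 := by
  have hrange : ∑ l ∈ Finset.Icc u v, ee (γ * l)
      = ∑ i ∈ Finset.range (v + 1 - u).toNat, ee (γ * (u + i : ℤ)) := by
    refine Finset.sum_nbij' (fun l => (l - u).toNat) (fun i => u + i) ?_ ?_ ?_ ?_ ?_
    · intro l hl; simp only [Finset.mem_Icc, Finset.mem_range] at *; omega
    · intro l hl; simp only [Finset.mem_Icc, Finset.mem_range] at *; omega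
    · intro l hl; simp only [Finset.mem_Icc] at *; omega
    · intro l hl; simp
    · intro l hl
      simp only [Finset.mem_Icc] at hl
      rw [Int.toNat_of_nonneg (by omega)]
      simp
  rw [hrange, ← norm_mul, Finset.sum_mul]
  have htel : ∀ i ∈ Finset.range (v + 1 - u).toNat, ee (γ * (u + i : ℤ)) * (ee γ - 1)
      = ee (γ * (u + (i + 1 : ℕ) : ℤ)) - ee (γ * (u + i : ℤ)) := by
    intro i _
    rw [mul_sub, mul_one, ← ee_add]
    congr 2
    push_cast
    ring
  rw [Finset.sum_congr rfl htel, Finset.sum_range_sub fun i : ℕ => ee (γ * (u + i : ℤ))]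
  refine (norm_sub_le _ _).trans ?_
  rw [norm_ee, norm_ee]
  norm_num

/-- The quadratic Weyl sum over `|k| ≤ N`. -/
def theta (N : ℤ) (α : ℝ) : ℂ := ∑ k ∈ Finset.Icc (-N) N, ee (α * k ^ 2)

lemma gauss_eq_theta (P : ℕ) [NeZero P] (N : ℤ) (a : ZMod P) :
    gauss P N a = theta N (a.val / P) := by
  refine Finset.sum_congr rfl fun k _ => ?_
  have h := ZMod.stdAddChar_coe (N := P) ((a.val : ℤ) * k ^ 2)
  push_cast at h
  rw [ZMod.natCast_zmod_val] at h
  rw [h, ee]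
  congr 1
  push_cast
  ring

/-- The correlation sums produced by Weyl differencing. -/
def weylCorr (N : ℤ) (β : ℝ) (h : ℤ) : ℝ :=
  ‖∑ l ∈ Finset.Icc (max (-N) (-N - h)) (min N (N - h)), ee (β * h * l)‖

lemma normSq_theta_le (N : ℤ) (α : ℝ) :
    ‖theta N α‖ ^ 2 ≤ ∑ h ∈ Finset.Icc (-(2 * N)) (2 * N), weylCorr N (2 * α) h := by
  have hmul : ((‖theta N α‖ ^ 2 : ℝ) : ℂ)
      = ∑ l ∈ Finset.Icc (-N) N, ∑ k ∈ Finset.Icc (-N) N, ee (α * k ^ 2 - α * l ^ 2) := by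
    rw [← Complex.normSq_eq_norm_sq, ← Complex.mul_conj, theta, map_sum, Finset.sum_mul_sum,
      Finset.sum_comm]
    refine Finset.sum_congr rfl fun l _ => Finset.sum_congr rfl fun k _ => ?_
    rw [conj_ee, ← ee_add, sub_eq_add_neg]
  have hshift : ∀ l ∈ Finset.Icc (-N) N,
      ∑ k ∈ Finset.Icc (-N) N, ee (α * k ^ 2 - α * l ^ 2)
      = ∑ h ∈ Finset.Icc (-(2 * N)) (2 * N),
        if l + h ∈ Finset.Icc (-N) N then ee (α * h ^ 2) * ee (2 * α * h * l) else 0 := by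
    intro l hl
    rw [← Finset.sum_filter]
    refine Finset.sum_nbij' (fun k => k - l) (fun h => l + h) ?_ ?_ ?_ ?_ ?_
    · intro k hk; simp only [Finset.mem_filter, Finset.mem_Icc] at *; omega
    · intro k hk; simp only [Finset.mem_filter, Finset.mem_Icc] at *; omega
    · intro k hk; simp
    · intro k hk; simp
    · intro k hk
      rw [← ee_add]
      congr 1
      push_cast
      ring
  rw [Finset.sum_congr rfl hshift, Finset.sum_comm] at hmul
  have hnorm := congrArg norm hmul
  rw [Complex.norm_real, Real.norm_eq_abs, abs_of_nonneg (by positivity)] at hnorm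
  rw [hnorm]
  refine (norm_sum_le _ _).trans (Finset.sum_le_sum fun h _ => le_of_eq ?_)
  rw [← Finset.sum_filter, ← Finset.mul_sum, norm_mul, norm_ee, one_mul, weylCorr]
  congr 2
  ext l
  simp only [Finset.mem_filter, Finset.mem_Icc, max_le_iff, le_min_iff]
  omega

lemma weylCorr_le {N : ℤ} (hN : 1 ≤ N) (β : ℝ) (h : ℤ) : weylCorr N β h ≤ 3 * N := by
  refine (norm_sum_le _ _).trans ?_
  simp only [norm_ee, Finset.sum_const, nsmul_eq_mul, mul_one, Int.card_Icc]
  have h1 : (((min N (N - h) + 1 - max (-N) (-N - h)).toNat : ℕ) : ℤ) ≤ 3 * N := by omega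
  exact_mod_cast h1

lemma weylCorr_mul_le (N : ℤ) (β : ℝ) (h : ℤ) : weylCorr N β h * ‖ee (β * h) - 1‖ ≤ 2 :=
  norm_sum_ee_mul_le _ _ _

lemma weylCorr_nonneg (N : ℤ) (β : ℝ) (h : ℤ) : 0 ≤ weylCorr N β h := norm_nonneg _

lemma norm_ee_residue {q r : ℕ} (hr : 0 < r) (hrq : r < q) {y : ℝ} (hy : |y| ≤ 1 / (4 * q)) :
    2 / q * min (r : ℝ) (q - r) ≤ ‖ee (r / q + y) - 1‖ := by
  have hq : (0 : ℝ) < q := by exact_mod_cast hr.trans hrq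
  have hr1 : (1 : ℝ) ≤ r := by exact_mod_cast hr
  have hrq1 : (r : ℝ) + 1 ≤ q := by exact_mod_cast hrq
  have hmain : 4 / q * min (r : ℝ) (q - r) ≤ ‖ee (r / q) - 1‖ := by
    rcases le_total (r : ℝ) (q - r) with h | h
    · rw [min_eq_left h]
      have h1 : |(r : ℝ) / q| = r / q := abs_of_nonneg (by positivity)
      have h2 := le_norm_ee_sub_one (x := r / q)
        (by rw [h1, div_le_div_iff₀ hq (by norm_num)]; linarith)
      rw [h1] at h2
      linarith [show 4 / (q : ℝ) * r = 4 * (r / q) by ring]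
    · rw [min_eq_right h]
      have h1 : |(r : ℝ) / q - (1 : ℤ)| = (q - r) / q := by
        rw [abs_sub_comm, abs_of_nonneg]
        · push_cast; field_simp
        · push_cast; rw [sub_nonneg, div_le_one hq]; linarith
      have h2 := le_norm_ee_sub_one (x := r / q - (1 : ℤ))
        (by rw [h1, div_le_div_iff₀ hq (by norm_num)]; linarith)
      rw [h1, ee_sub_intCast] at h2
      linarith [show 4 / (q : ℝ) * (q - r) = 4 * ((q - r) / q) by ring]
  have htri : ‖ee (r / q) - 1‖ ≤ ‖ee (r / q + y) - 1‖ + ‖ee y - 1‖ := by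
    have h1 : ‖ee (r / q) - 1‖ = ‖ee y * (ee (r / q) - 1)‖ := by rw [norm_mul, norm_ee, one_mul]
    rw [h1]
    refine le_trans (le_of_eq ?_) (norm_sub_le _ _)
    rw [ee_add]
    congr 1
    ring
  have hy' : ‖ee y - 1‖ ≤ 2 / q * 1 := by
    refine (norm_ee_sub_one_le y).trans ?_
    calc 7 * |y| ≤ 7 * (1 / (4 * q)) := by gcongr
      _ ≤ 2 / q * 1 := by
        rw [mul_one, mul_one_div, div_le_div_iff₀ (by positivity) hq]; linarith
  have hmin : (1 : ℝ) ≤ min (r : ℝ) (q - r) := le_min hr1 (by linarith)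
  have : 2 / (q : ℝ) * 1 ≤ 2 / q * min (r : ℝ) (q - r) := by gcongr
  have : 4 / (q : ℝ) * min (r : ℝ) (q - r) = 2 * (2 / q * min (r : ℝ) (q - r)) := by ring
  linarith

/-- The majorant of the correlation sums on a nonzero residue class. -/
def resBound (q : ℕ) (z : ZMod q) : ℝ :=
  if z = 0 then 0 else q / z.val + q / (q - z.val)

lemma resBound_nonneg (q : ℕ) [NeZero q] (z : ZMod q) : 0 ≤ resBound q z := by
  rw [resBound]
  split_ifs
  · exact le_rfl
  · have : (z.val : ℝ) < q := by exact_mod_cast z.val_lt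
    have : (0 : ℝ) < q - z.val := by linarith
    positivity

lemma sum_resBound_le (q : ℕ) [NeZero q] : ∑ z, resBound q z ≤ 2 * q * (1 + Real.log q) := by
  have hH : ∑ i ∈ Finset.range q, ((i : ℝ) + 1)⁻¹ ≤ 1 + Real.log q := by
    have h := harmonic_le_one_add_log q
    simp only [harmonic] at h
    push_cast at h
    exact h
  have h1 : ∑ z, resBound q z ≤ ∑ r ∈ Finset.range q,
      ((q : ℝ) * ((r : ℝ) + 1)⁻¹ + q * (((q - 1 - r : ℕ) : ℝ) + 1)⁻¹) := by
    have h2 : ∑ z, resBound q z = ∑ r ∈ Finset.range q, resBound q (r : ZMod q) := by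
      refine Finset.sum_nbij' (fun z => z.val) (fun r => (r : ZMod q)) ?_ ?_ ?_ ?_ ?_
      · intro z _; exact Finset.mem_range.2 z.val_lt
      · intro r _; exact Finset.mem_univ _
      · intro z _; exact ZMod.natCast_zmod_val z
      · intro r hr; exact ZMod.val_cast_of_lt (Finset.mem_range.1 hr)
      · intro z _; rw [ZMod.natCast_zmod_val]
    have h3 : ∀ r ∈ Finset.range q, resBound q (r : ZMod q) ≤
        (if r = 0 then 0 else (q : ℝ) * (r : ℝ)⁻¹) + q * (((q - 1 - r : ℕ) : ℝ) + 1)⁻¹ := by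
      intro r hr
      rw [Finset.mem_range] at hr
      have h4 : ((q - 1 - r : ℕ) : ℝ) + 1 = q - r := by
        rw [Nat.sub_sub, Nat.cast_sub (by omega)]; push_cast; ring
      have h5 : (0 : ℝ) < q - r := by rw [sub_pos]; exact_mod_cast hr
      rw [resBound, h4, ZMod.val_cast_of_lt hr]
      split_ifs with h6 h7 h7
      · positivity
      · positivity
      · exact absurd (by rw [h7, Nat.cast_zero]) h6
      · rw [div_eq_mul_inv, div_eq_mul_inv]
    rw [h2]
    refine (Finset.sum_le_sum h3).trans ?_
    rw [Finset.sum_add_distrib, Finset.sum_add_distrib]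
    gcongr ?_ + _
    obtain ⟨n, hn⟩ := Nat.exists_eq_succ_of_ne_zero (NeZero.ne q)
    rw [hn, Finset.sum_range_succ', Finset.sum_range_succ]
    simp only [if_true, add_zero, Nat.succ_ne_zero, if_false]
    push_cast
    linarith [show (0 : ℝ) ≤ ((n : ℝ) + 1) * ((n : ℝ) + 1)⁻¹ by positivity]
  refine h1.trans ?_
  rw [Finset.sum_add_distrib, Finset.sum_range_reflect
    (fun i => (q : ℝ) * ((i : ℝ) + 1)⁻¹) q, ← Finset.mul_sum]
  have : (0 : ℝ) ≤ q := Nat.cast_nonneg q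
  nlinarith

lemma card_filter_modEq_le {q : ℕ} [NeZero q] (N : ℤ) (hN : 1 ≤ N) (z : ZMod q) :
    (((Finset.Icc (-(2 * N)) (2 * N)).filter fun h : ℤ => (h : ZMod q) = z).card : ℝ)
      ≤ (4 * N + 1) / q + 1 := by
  have hq : (0 : ℝ) < q := Nat.cast_pos.2 (NeZero.pos q)
  have h := Int.Ioc_filter_modEq_card (-(2 * N) - 1) (2 * N) (r := q)
    (by exact_mod_cast NeZero.pos q) z.val
  have hset : (Finset.Icc (-(2 * N)) (2 * N)).filter (fun h : ℤ => (h : ZMod q) = z)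
      = (Finset.Ioc (-(2 * N) - 1) (2 * N)).filter fun h : ℤ => h ≡ z.val [ZMOD q] := by
    ext x
    simp only [Finset.mem_filter, Finset.mem_Icc, Finset.mem_Ioc]
    rw [← ZMod.intCast_eq_intCast_iff, Int.cast_natCast, ZMod.natCast_zmod_val]
    refine and_congr_left fun _ => ?_
    omega
  rw [hset]
  have h' : (((Finset.Ioc (-(2 * N) - 1) (2 * N)).filter fun h : ℤ => h ≡ z.val [ZMOD q]).card : ℝ)
      = ((max (⌊(((2 * N : ℤ) : ℚ) - ((z.val : ℤ) : ℚ)) / ((q : ℤ) : ℚ)⌋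
        - ⌊(((-(2 * N) - 1 : ℤ) : ℚ) - ((z.val : ℤ) : ℚ)) / ((q : ℤ) : ℚ)⌋) 0 : ℤ) : ℝ) := by
    rw [← h]; simp
  rw [h']
  have hN' : (1 : ℝ) ≤ N := by exact_mod_cast hN
  rw [Int.cast_max, max_le_iff]
  refine ⟨?_, by push_cast; positivity⟩
  set A : ℚ := (((2 * N : ℤ) : ℚ) - ((z.val : ℤ) : ℚ)) / ((q : ℤ) : ℚ) with hA
  set B : ℚ := (((-(2 * N) - 1 : ℤ) : ℚ) - ((z.val : ℤ) : ℚ)) / ((q : ℤ) : ℚ) with hB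
  have h1 : (⌊A⌋ : ℚ) ≤ A := Int.floor_le A
  have h2 : B < ⌊B⌋ + 1 := Int.lt_floor_add_one B
  have h3 : ((⌊A⌋ - ⌊B⌋ : ℤ) : ℚ) ≤ (4 * N + 1) / q + 1 := by
    have : A - B = (4 * N + 1) / q := by
      rw [hA, hB, ← sub_div]
      push_cast
      ring_nf
    push_cast
    linarith
  exact_mod_cast h3

lemma sum_weylCorr_not_dvd {N : ℤ} (hN : 1 ≤ N) {q : ℕ} [NeZero q] (hqN : (q : ℤ) ≤ 8 * N)
    {b : ℤ} (hb : IsUnit (b : ZMod q)) {β : ℝ} (hβ : |q * β - b| ≤ 1 / (8 * N)) :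
    ∑ h ∈ (Finset.Icc (-(2 * N)) (2 * N)).filter (fun h : ℤ => ¬ (q : ℤ) ∣ h), weylCorr N β h
      ≤ 26 * N * (1 + Real.log (8 * N)) := by
  have hq : (0 : ℝ) < q := Nat.cast_pos.2 (NeZero.pos q)
  have hN' : (1 : ℝ) ≤ N := by exact_mod_cast hN
  have hqN' : (q : ℝ) ≤ 8 * N := by exact_mod_cast hqN
  have hterm : ∀ h ∈ (Finset.Icc (-(2 * N)) (2 * N)).filter (fun h : ℤ => ¬ (q : ℤ) ∣ h),
      weylCorr N β h ≤ resBound q ((b : ZMod q) * (h : ZMod q)) := by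
    intro h hh
    rw [Finset.mem_filter, Finset.mem_Icc] at hh
    obtain ⟨⟨hl, hu⟩, hnd⟩ := hh
    set z : ZMod q := (b : ZMod q) * (h : ZMod q) with hz
    have hz0 : z ≠ 0 := by
      rw [hz, Ne, hb.mul_right_eq_zero, ZMod.intCast_zmod_eq_zero_iff_dvd]
      exact hnd
    have hr : 0 < z.val := ZMod.val_pos.2 hz0
    obtain ⟨m, hm⟩ : (q : ℤ) ∣ b * h - z.val := by
      rw [← ZMod.intCast_zmod_eq_zero_iff_dvd]
      push_cast
      rw [ZMod.natCast_zmod_val, ← hz, sub_self]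
    have hy : |(h : ℝ) * (q * β - b) / q| ≤ 1 / (4 * q) := by
      have hh : |(h : ℝ)| ≤ 2 * N := by
        rw [abs_le]; constructor <;> exact_mod_cast (by omega)
      rw [abs_div, abs_mul, abs_of_pos hq, div_le_div_iff₀ hq (by positivity)]
      calc |(h : ℝ)| * |q * β - b| * (4 * q) ≤ (2 * N) * (1 / (8 * N)) * (4 * q) := by gcongr
        _ = 1 * q := by field_simp; ring
    have hmR : (b : ℝ) * h - z.val = q * m := by exact_mod_cast hm
    have heq : ee (β * h) = ee (z.val / q + (h : ℝ) * (q * β - b) / q) := by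
      rw [← ee_sub_intCast _ m]
      congr 1
      field_simp
      linarith
    have h1 := norm_ee_residue hr z.val_lt hy
    rw [← heq] at h1
    have h2 := weylCorr_mul_le N β h
    have hr1 : (0 : ℝ) < z.val := by exact_mod_cast hr
    have hrq1 : (0 : ℝ) < q - z.val := by rw [sub_pos]; exact_mod_cast z.val_lt
    have h3 : weylCorr N β h * min (z.val : ℝ) (q - z.val) ≤ q := by
      have h4 : weylCorr N β h * (2 / q * min (z.val : ℝ) (q - z.val)) ≤ 2 :=
        (mul_le_mul_of_nonneg_left h1 (weylCorr_nonneg N β h)).trans h2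
      have h5 : weylCorr N β h * (2 / q * min (z.val : ℝ) (q - z.val))
          = 2 * (weylCorr N β h * min (z.val : ℝ) (q - z.val)) / q := by ring
      rw [h5, div_le_iff₀ hq] at h4
      linarith
    rw [resBound, if_neg hz0]
    rcases min_choice (z.val : ℝ) (q - z.val) with h6 | h6 <;> rw [h6] at h3
    · rw [← le_div_iff₀ hr1] at h3
      have : 0 ≤ (q : ℝ) / (q - z.val) := by positivity
      linarith
    · rw [← le_div_iff₀ hrq1] at h3
      have : 0 ≤ (q : ℝ) / z.val := by positivity
      linarith
  have hlog : 0 ≤ 1 + Real.log q := by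
    have : 0 ≤ Real.log q := Real.log_natCast_nonneg q
    linarith
  calc _ ≤ ∑ h ∈ (Finset.Icc (-(2 * N)) (2 * N)).filter (fun h : ℤ => ¬ (q : ℤ) ∣ h),
        resBound q ((b : ZMod q) * (h : ZMod q)) := Finset.sum_le_sum hterm
    _ ≤ ∑ h ∈ Finset.Icc (-(2 * N)) (2 * N), resBound q ((b : ZMod q) * (h : ZMod q)) :=
        Finset.sum_le_sum_of_subset_of_nonneg (Finset.filter_subset _ _)
          fun _ _ _ => resBound_nonneg q _
    _ = ∑ z : ZMod q, ∑ h ∈ (Finset.Icc (-(2 * N)) (2 * N)).filter (fun h : ℤ => (h : ZMod q) = z),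
        resBound q ((b : ZMod q) * (h : ZMod q)) := (Finset.sum_fiberwise _ _ _).symm
    _ ≤ ∑ z : ZMod q, ((4 * N + 1) / q + 1) * resBound q ((b : ZMod q) * z) := by
        refine Finset.sum_le_sum fun z _ => ?_
        rw [Finset.sum_congr rfl (fun h hh => by rw [(Finset.mem_filter.1 hh).2]),
          Finset.sum_const, nsmul_eq_mul]
        exact mul_le_mul_of_nonneg_right (card_filter_modEq_le N hN z) (resBound_nonneg q _)
    _ = ((4 * N + 1) / q + 1) * ∑ z, resBound q z := by
        rw [← Finset.mul_sum]
        congr 1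
        exact Equiv.sum_comp (Units.mulLeft hb.unit) (resBound q)
    _ ≤ ((4 * N + 1) / q + 1) * (2 * q * (1 + Real.log q)) := by
        gcongr; exact sum_resBound_le q
    _ = 2 * (4 * N + 1 + q) * (1 + Real.log q) := by field_simp
    _ ≤ 26 * N * (1 + Real.log (8 * N)) := by
        have : 2 * (4 * (N : ℝ) + 1 + q) ≤ 26 * N := by linarith
        gcongr

lemma sum_inv_sqrt_le (J : ℕ) : ∑ j ∈ Finset.Icc 1 J, (√(j : ℝ))⁻¹ ≤ 2 * √(J : ℝ) := by
  induction J with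
  | zero => simp
  | succ J ih =>
    rw [Finset.sum_Icc_succ_top (by omega)]
    have h1 : (0 : ℝ) < √((J + 1 : ℕ) : ℝ) := Real.sqrt_pos.2 (by positivity)
    have h2 : √((J + 1 : ℕ) : ℝ) ^ 2 = J + 1 := by rw [Real.sq_sqrt (by positivity)]; push_cast; rfl
    have h3 : √(J : ℝ) ^ 2 = J := Real.sq_sqrt (by positivity)
    have h4 : (√((J + 1 : ℕ) : ℝ))⁻¹ ≤ 2 * √((J + 1 : ℕ) : ℝ) - 2 * √(J : ℝ) := by
      rw [inv_le_iff_one_le_mul₀ h1]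
      nlinarith [sq_nonneg (√((J + 1 : ℕ) : ℝ) - √(J : ℝ))]
    linarith

lemma weylCorr_mul_abs_le {N : ℤ} (hN : 1 ≤ N) {q : ℕ} (hq : 0 < q) {b : ℤ} {β : ℝ}
    (hβ : |q * β - b| ≤ 1 / (8 * N)) {j : ℤ} (hj : |j| * q ≤ 2 * N) :
    weylCorr N β (j * q) * (2 * |(j : ℝ)| * |q * β - b|) ≤ 1 := by
  have hN' : (1 : ℝ) ≤ N := by exact_mod_cast hN
  have hq' : (1 : ℝ) ≤ q := by exact_mod_cast hq
  have hj' : |(j : ℝ)| * q ≤ 2 * N := by exact_mod_cast hj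
  have hj2 : |(j : ℝ)| ≤ 2 * N := by nlinarith [abs_nonneg (j : ℝ)]
  have h1 : |(j : ℝ) * (q * β - b)| ≤ 1 / 2 := by
    rw [abs_mul]
    calc |(j : ℝ)| * |q * β - b| ≤ (2 * N) * (1 / (8 * N)) := by gcongr
      _ ≤ 1 / 2 := by
        rw [mul_one_div, div_le_div_iff₀ (by positivity) (by norm_num)]; linarith
  have h2 := le_norm_ee_sub_one h1
  have h3 : ee (β * ((j * q : ℤ) : ℝ)) = ee ((j : ℝ) * (q * β - b)) := by
    rw [← ee_sub_intCast _ (j * b)]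
    congr 1
    push_cast
    ring
  have h4 := weylCorr_mul_le N β (j * q)
  rw [h3] at h4
  have h5 := (mul_le_mul_of_nonneg_left h2 (weylCorr_nonneg N β (j * q))).trans h4
  rw [abs_mul] at h5
  linarith

lemma sum_weylCorr_dvd {N : ℤ} (hN : 1 ≤ N) {q : ℕ} (hq : 0 < q) {b : ℤ} {β : ℝ}
    (hβ : |q * β - b| ≤ 1 / (8 * N)) :
    ∑ h ∈ (Finset.Icc (-(2 * N)) (2 * N)).filter (fun h : ℤ => (q : ℤ) ∣ h ∧ h ≠ 0),
      weylCorr N β h ≤ 12 * (N ^ 2 / q) / √(max 1 (N ^ 2 * |β - b / q|)) := by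
  classical
  have hN' : (1 : ℝ) ≤ N := by exact_mod_cast hN
  have hq' : (1 : ℝ) ≤ q := by exact_mod_cast hq
  obtain ⟨n, rfl⟩ := Int.eq_ofNat_of_zero_le (show 0 ≤ N by omega)
  rw [Int.cast_natCast] at *
  set J := 2 * n / q with hJ
  have hJq : J * q ≤ 2 * n := Nat.div_mul_le_self _ _
  have hJ' : (J : ℝ) ≤ 2 * n / q := by
    rw [le_div_iff₀ (by linarith)]; exact_mod_cast hJq
  have hsum : ∑ h ∈ (Finset.Icc (-(2 * (n : ℤ))) (2 * n)).filter (fun h : ℤ => (q : ℤ) ∣ h ∧ h ≠ 0),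
      weylCorr n β h
      ≤ ∑ j ∈ Finset.Icc 1 J, weylCorr n β ((j : ℤ) * q)
        + ∑ j ∈ Finset.Icc 1 J, weylCorr n β ((-(j : ℤ)) * q) := by
    have hsub : (Finset.Icc (-(2 * (n : ℤ))) (2 * n)).filter (fun h : ℤ => (q : ℤ) ∣ h ∧ h ≠ 0)
        ⊆ (Finset.Icc 1 J).image (fun j : ℕ => (j : ℤ) * q)
          ∪ (Finset.Icc 1 J).image (fun j : ℕ => (-(j : ℤ)) * q) := by
      intro h hh
      rw [Finset.mem_filter, Finset.mem_Icc] at hh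
      obtain ⟨⟨h1, h2⟩, ⟨c, rfl⟩, h3⟩ := hh
      have hc0 : c ≠ 0 := right_ne_zero_of_mul h3
      have hc : c.natAbs ∈ Finset.Icc 1 J := by
        rw [Finset.mem_Icc, hJ, Nat.le_div_iff_mul_le hq]
        refine ⟨by omega, ?_⟩
        have : |c| * q ≤ 2 * n := by
          rw [mul_comm, ← abs_of_nonneg (show (0 : ℤ) ≤ q by omega), ← abs_mul, abs_le]
          exact ⟨h1, h2⟩
        rw [Int.abs_eq_natAbs] at this
        exact_mod_cast this
      rw [Finset.mem_union, Finset.mem_image, Finset.mem_image]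
      rcases le_total 0 c with h4 | h4
      · exact Or.inl ⟨_, hc, by rw [Int.natAbs_of_nonneg h4, mul_comm]⟩
      · exact Or.inr ⟨_, hc, by rw [Int.ofNat_natAbs_of_nonpos h4, neg_neg, mul_comm]⟩
    refine (Finset.sum_le_sum_of_subset_of_nonneg hsub fun _ _ _ => weylCorr_nonneg _ _ _).trans ?_
    have hu := Finset.sum_union_inter (s₁ := (Finset.Icc 1 J).image (fun j : ℕ => (j : ℤ) * q))
      (s₂ := (Finset.Icc 1 J).image (fun j : ℕ => (-(j : ℤ)) * q)) (f := weylCorr n β)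
    have h1 := Finset.sum_image_le_of_nonneg (s := Finset.Icc 1 J) (g := fun j : ℕ => (j : ℤ) * q)
      (f := weylCorr n β) fun _ _ => weylCorr_nonneg _ _ _
    have h2 := Finset.sum_image_le_of_nonneg (s := Finset.Icc 1 J)
      (g := fun j : ℕ => (-(j : ℤ)) * q) (f := weylCorr n β) fun _ _ => weylCorr_nonneg _ _ _
    have h3 := Finset.sum_nonneg (s := (Finset.Icc 1 J).image (fun j : ℕ => (j : ℤ) * q)
      ∩ (Finset.Icc 1 J).image (fun j : ℕ => (-(j : ℤ)) * q)) (f := weylCorr n β)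
      fun _ _ => weylCorr_nonneg _ _ _
    linarith
  refine hsum.trans ?_
  have hη : (n : ℝ) ^ 2 * |β - b / q| = n ^ 2 / q * |q * β - b| := by
    have : q * β - b = q * (β - b / q) := by field_simp
    rw [this, abs_mul, abs_of_pos (by linarith : (0 : ℝ) < q)]
    field_simp
  rcases le_total (1 : ℝ) (n ^ 2 * |β - b / q|) with hx | hx
  · rw [max_eq_right hx, hη]
    rw [hη] at hx
    set η := |q * β - b| with hηdef
    have hη0 : 0 < η := by
      by_contra! h
      have : η = 0 := le_antisymm h (abs_nonneg _)
      rw [this] at hx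
      norm_num at hx
    have hterm : ∀ s : ℤ, |s| = 1 → ∀ j ∈ Finset.Icc 1 J, weylCorr n β ((s * (j : ℤ)) * q)
        ≤ √(3 * n / (2 * η)) * (√(j : ℝ))⁻¹ := by
      intro s hs j hj
      rw [Finset.mem_Icc] at hj
      have hj0 : (0 : ℝ) < j := by exact_mod_cast hj.1
      have habs : |s * (j : ℤ)| = j := by rw [abs_mul, hs, one_mul, abs_of_nonneg (by omega)]
      have h1 := weylCorr_mul_abs_le hN hq hβ (j := s * j) (by
        rw [habs]
        have := (Nat.mul_le_mul_right q hj.2).trans hJq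
        exact_mod_cast this)
      have habs' : |((s * (j : ℤ) : ℤ) : ℝ)| = j := by exact_mod_cast habs
      rw [habs'] at h1
      have h2 := weylCorr_le hN β (s * j * q)
      have h3 := weylCorr_nonneg n β (s * j * q)
      rw [← Real.sqrt_inv, ← Real.sqrt_mul (by positivity)]
      apply Real.le_sqrt_of_sq_le
      rw [← div_eq_mul_inv, div_div, le_div_iff₀ (by positivity)]
      push_cast at h2
      calc weylCorr n β (s * j * q) ^ 2 * (2 * η * j)
          = weylCorr n β (s * j * q) * (weylCorr n β (s * j * q) * (2 * j * η)) := by ring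
        _ ≤ (3 * n) * 1 := by gcongr
        _ = 3 * n := by ring
    have h1 := Finset.sum_le_sum (hterm 1 rfl)
    have h2 := Finset.sum_le_sum (hterm (-1) rfl)
    rw [← Finset.mul_sum] at h1 h2
    simp only [one_mul, neg_one_mul] at h1 h2
    have h3 := mul_le_mul_of_nonneg_left (sum_inv_sqrt_le J) (Real.sqrt_nonneg (3 * n / (2 * η)))
    have h4 : √(3 * n / (2 * η)) * √(J : ℝ) ≤ 2 * (n ^ 2 / q) / √(n ^ 2 / q * η) := by
      rw [← Real.sqrt_mul (by positivity), Real.sqrt_le_left (by positivity), div_pow,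
        Real.sq_sqrt (by positivity)]
      calc 3 * n / (2 * η) * (J : ℝ) ≤ 3 * n / (2 * η) * (2 * n / q) := by gcongr
        _ ≤ _ := by
          rw [div_mul_div_comm, div_le_div_iff₀ (by positivity) (by positivity)]
          have h5 : (2 * ((n : ℝ) ^ 2 / q)) ^ 2 * (2 * η * q) = 8 * (n ^ 4 * η / q) := by
            field_simp; ring
          have h6 : 3 * (n : ℝ) * (2 * n) * (n ^ 2 / q * η) = 6 * (n ^ 4 * η / q) := by
            field_simp; ring
          rw [h5, h6]
          have : 0 ≤ (n : ℝ) ^ 4 * η / q := by positivity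
          linarith
    have h7 : 12 * ((n : ℝ) ^ 2 / q) / √(n ^ 2 / q * η)
        = 6 * (2 * (n ^ 2 / q) / √(n ^ 2 / q * η)) := by ring
    have h8 : (0 : ℝ) ≤ √(3 * n / (2 * η)) * √(J : ℝ) := by positivity
    rw [h7]
    linarith
  · rw [max_eq_left hx, Real.sqrt_one, div_one]
    have h1 : ∀ g : ℕ → ℤ, ∑ j ∈ Finset.Icc 1 J, weylCorr n β (g j) ≤ J * (3 * n) := by
      intro g
      refine (Finset.sum_le_sum fun j _ => weylCorr_le hN β (g j)).trans ?_
      simp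
    have h2 : (J : ℝ) * (3 * n) ≤ 6 * (n ^ 2 / q) := by
      calc (J : ℝ) * (3 * n) ≤ 2 * n / q * (3 * n) := by gcongr
        _ = _ := by ring
    linarith [h1 fun j => (j : ℤ) * q, h1 fun j => (-(j : ℤ)) * q]

/-- Weyl's inequality, with the rational approximation made explicit. -/
lemma exists_normSq_theta_le {N : ℕ} (hN : 1 ≤ N) {α : ℝ} (h0 : 0 ≤ α) (h1 : α < 1) :
    ∃ q ∈ Finset.Icc 1 (8 * N), ∃ b ∈ Finset.range (2 * q + 1), ‖theta N α‖ ^ 2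
      ≤ 29 * N * (1 + Real.log (8 * N))
        + 12 * (N ^ 2 / q) / √(max 1 (N ^ 2 * |2 * α - b / q|)) := by
  have hN' : (1 : ℝ) ≤ N := by exact_mod_cast hN
  have hNz : (1 : ℤ) ≤ N := by exact_mod_cast hN
  obtain ⟨r, hr, hden⟩ := Real.exists_rat_abs_sub_le_and_den_le (2 * α) (n := 8 * N) (by omega)
  have hq : 0 < r.den := r.den_pos
  have hq' : (0 : ℝ) < r.den := by exact_mod_cast hq
  have hη : |r.den * (2 * α) - r.num| ≤ 1 / ((8 * N : ℕ) + 1) := by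
    have h2 : (r.den : ℝ) * (2 * α) - r.num = r.den * (2 * α - r) := by
      rw [mul_sub, show (r.den : ℝ) * (r : ℝ) = r.num by exact_mod_cast Rat.den_mul_eq_num r]
    rw [h2, abs_mul, abs_of_pos hq']
    calc (r.den : ℝ) * |2 * α - r| ≤ r.den * (1 / (((8 * N : ℕ) + 1) * r.den)) := by gcongr
      _ = _ := by field_simp
  have hη' : |r.den * (2 * α) - r.num| ≤ 1 / (8 * ((N : ℤ) : ℝ)) := by
    refine hη.trans ?_
    push_cast
    gcongr
    linarith
  have hη1 : |r.den * (2 * α) - r.num| < 1 := by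
    refine hη.trans_lt ?_
    push_cast
    rw [div_lt_one (by positivity)]
    linarith
  rw [abs_lt] at hη1
  have hb0 : 0 ≤ r.num := by
    have : (-1 : ℝ) < r.num := by nlinarith [mul_nonneg hq'.le h0]
    have : (-1 : ℤ) < r.num := by exact_mod_cast this
    omega
  have hb1 : r.num < 2 * r.den + 1 := by
    have : (r.num : ℝ) < 2 * r.den + 1 := by nlinarith
    exact_mod_cast this
  obtain ⟨b, hb⟩ := Int.eq_ofNat_of_zero_le hb0
  refine ⟨r.den, Finset.mem_Icc.2 ⟨hq, hden⟩, b, Finset.mem_range.2 (by omega), ?_⟩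
  have : NeZero r.den := ⟨hq.ne'⟩
  have hunit : IsUnit (r.num : ZMod r.den) := by
    have := r.reduced
    rw [hb, Int.natAbs_natCast] at this
    rw [hb, Int.cast_natCast]
    exact (ZMod.isUnit_iff_coprime _ _).2 this
  have hA := sum_weylCorr_not_dvd hNz (by exact_mod_cast hden) hunit hη'
  have hB := sum_weylCorr_dvd hNz hq hη'
  have hC := normSq_theta_le N α
  have hsplit : ∑ h ∈ Finset.Icc (-(2 * (N : ℤ))) (2 * N), weylCorr N (2 * α) h
      ≤ ∑ h ∈ (Finset.Icc (-(2 * (N : ℤ))) (2 * N)).filter (fun h : ℤ => ¬ (r.den : ℤ) ∣ h),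
          weylCorr N (2 * α) h
        + ∑ h ∈ (Finset.Icc (-(2 * (N : ℤ))) (2 * N)).filter (fun h : ℤ => (r.den : ℤ) ∣ h ∧ h ≠ 0),
          weylCorr N (2 * α) h + 3 * N := by
    rw [Finset.sum_filter, Finset.sum_filter, ← Finset.sum_add_distrib]
    have hmem : (0 : ℤ) ∈ Finset.Icc (-(2 * (N : ℤ))) (2 * N) := by
      rw [Finset.mem_Icc]; omega
    rw [← Finset.sum_erase_add _ _ hmem, ← Finset.sum_erase_add _ _ hmem]
    have h2 := weylCorr_le hNz (2 * α) 0
    rw [Int.cast_natCast] at h2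
    have h3 : ∑ h ∈ (Finset.Icc (-(2 * (N : ℤ))) (2 * N)).erase 0, weylCorr N (2 * α) h
        = ∑ h ∈ (Finset.Icc (-(2 * (N : ℤ))) (2 * N)).erase 0,
          ((if ¬ (r.den : ℤ) ∣ h then weylCorr N (2 * α) h else 0)
            + if (r.den : ℤ) ∣ h ∧ h ≠ 0 then weylCorr N (2 * α) h else 0) := by
      refine Finset.sum_congr rfl fun h hh => ?_
      have := Finset.ne_of_mem_erase hh
      by_cases hd : (r.den : ℤ) ∣ h <;> simp [hd, this]
    rw [h3]
    simp only [dvd_zero, not_true_eq_false, if_false, ne_eq, and_false, add_zero]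
    linarith
  rw [Int.cast_natCast] at hA hB
  have hlog : 0 ≤ Real.log (8 * N) := Real.log_nonneg (by linarith)
  rw [hb, Int.cast_natCast] at hB
  have hNlog : 0 ≤ N * Real.log (8 * N) := by positivity
  linarith

lemma exists_sum_max_rpow_le : ∃ C : ℝ, 0 ≤ C ∧ ∀ (P : ℕ) (β : ℝ),
    ∑ a ∈ Finset.range P, (max 1 |2 * (a : ℝ) - β|) ^ (-(9 / 8) : ℝ) ≤ C := by
  have hs1 : Summable fun i : ℤ => |(i : ℝ)| ^ (-(9 / 8) : ℝ) :=
    Real.summable_abs_int_rpow (by norm_num)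
  have hs2 : Summable fun i : ℤ => if i = 0 then (1 : ℝ) else 0 :=
    (hasSum_ite_eq 0 1).summable
  set g : ℤ → ℝ := fun i => |(i : ℝ)| ^ (-(9 / 8) : ℝ) + if i = 0 then (1 : ℝ) else 0 with hg
  have hg0 : ∀ i, 0 ≤ g i := fun i => by simp only [hg]; positivity
  refine ⟨∑' i, g i, tsum_nonneg hg0, fun P β => ?_⟩
  set a₀ : ℤ := ⌊β / 2⌋ with ha₀
  have hterm : ∀ a ∈ Finset.range P,
      (max 1 |2 * (a : ℝ) - β|) ^ (-(9 / 8) : ℝ) ≤ g ((a : ℤ) - a₀) := by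
    intro a _
    have h1 : (a₀ : ℝ) ≤ β / 2 := Int.floor_le _
    have h2 : β / 2 < a₀ + 1 := Int.lt_floor_add_one _
    set i : ℤ := (a : ℤ) - a₀ with hi
    have hiR : (i : ℝ) = a - a₀ := by rw [hi]; push_cast; rfl
    by_cases hi0 : i = 0
    · have h3 : (max 1 |2 * (a : ℝ) - β|) ^ (-(9 / 8) : ℝ) ≤ 1 :=
        Real.rpow_le_one_of_one_le_of_nonpos (le_max_left _ _) (by norm_num)
      simp only [hg, hi0, if_true]
      have : (0 : ℝ) ≤ |((0 : ℤ) : ℝ)| ^ (-(9 / 8) : ℝ) := by positivity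
      linarith
    · simp only [hg, if_neg hi0, add_zero]
      have h4 : (1 : ℝ) ≤ |(i : ℝ)| := by exact_mod_cast Int.one_le_abs hi0
      refine Real.rpow_le_rpow_of_nonpos (by linarith) ?_ (by norm_num)
      rcases lt_or_ge |i| 2 with h5 | h5
      · have : |i| ≤ 1 := by omega
        have : |(i : ℝ)| ≤ 1 := by exact_mod_cast this
        exact this.trans (le_max_left _ _)
      · refine le_trans ?_ (le_max_right _ _)
        have h6 : (2 : ℝ) ≤ |(i : ℝ)| := by exact_mod_cast h5
        have h7 : 2 * (a : ℝ) - β = 2 * i - (β - 2 * a₀) := by rw [hiR]; ring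
        have h8 : |β - 2 * (a₀ : ℝ)| ≤ 2 := by rw [abs_le]; constructor <;> linarith
        have h9 := abs_sub_abs_le_abs_sub (2 * (i : ℝ)) (β - 2 * a₀)
        rw [abs_mul, abs_two] at h9
        rw [h7]
        linarith
  refine (Finset.sum_le_sum hterm).trans ?_
  rw [← Finset.sum_image (f := g) (g := fun a : ℕ => (a : ℤ) - a₀) (fun a _ b _ h => by
    simpa using h)]
  exact (hs1.add hs2).sum_le_tsum _ fun i _ => hg0 i

lemma sqrt_pow_nine {t : ℝ} (ht : 0 ≤ t) : √t ^ 9 = (t ^ 2) ^ (9 / 4 : ℝ) := by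
  rw [Real.sqrt_eq_rpow, ← Real.rpow_natCast, ← Real.rpow_mul ht, ← Real.rpow_natCast t 2,
    ← Real.rpow_mul ht]
  norm_num

lemma minor_term_le {N : ℕ} (hN : 1 ≤ N) :
    (29 * N * (1 + Real.log (8 * N))) ^ (9 / 4 : ℝ) ≤ 2117 ^ (9 / 4 : ℝ) * √(N : ℝ) ^ 5 := by
  have hN' : (1 : ℝ) ≤ N := by exact_mod_cast hN
  have hlog0 : 0 ≤ Real.log (8 * N) := Real.log_nonneg (by linarith)
  have hlog : Real.log (8 * N) ≤ 72 * (N : ℝ) ^ (1 / 9 : ℝ) := by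
    have h1 := Real.log_le_rpow_div (x := 8 * (N : ℝ)) (ε := 1 / 9) (by positivity) (by norm_num)
    rw [Real.mul_rpow (by norm_num) (by positivity)] at h1
    have h2 : (8 : ℝ) ^ (1 / 9 : ℝ) ≤ 8 := by
      conv_rhs => rw [← Real.rpow_one 8]
      exact Real.rpow_le_rpow_of_exponent_le (by norm_num) (by norm_num)
    have h3 : 0 ≤ (N : ℝ) ^ (1 / 9 : ℝ) := by positivity
    nlinarith
  have hone : 1 ≤ (N : ℝ) ^ (1 / 9 : ℝ) := Real.one_le_rpow hN' (by norm_num)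
  have hle : 29 * N * (1 + Real.log (8 * N)) ≤ 2117 * (N * (N : ℝ) ^ (1 / 9 : ℝ)) := by
    nlinarith
  calc (29 * N * (1 + Real.log (8 * N))) ^ (9 / 4 : ℝ)
      ≤ (2117 * (N * (N : ℝ) ^ (1 / 9 : ℝ))) ^ (9 / 4 : ℝ) := by gcongr
    _ = 2117 ^ (9 / 4 : ℝ) * √(N : ℝ) ^ 5 := by
      rw [Real.mul_rpow (by norm_num) (by positivity)]
      congr 1
      rw [Real.mul_rpow (by positivity) (by positivity), ← Real.rpow_mul (by positivity),
        ← Real.rpow_add (by positivity), Real.sqrt_eq_rpow, ← Real.rpow_natCast,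
        ← Real.rpow_mul (by positivity)]
      norm_num

lemma major_term_eq {N q x : ℝ} (hN : 0 ≤ N) (hq : 0 < q) (hx : 0 < x) :
    (12 * (N ^ 2 / q) / √x) ^ (9 / 4 : ℝ)
      = 12 ^ (9 / 4 : ℝ) * (√N ^ 9 * (q ^ (-(9 / 4) : ℝ) * x ^ (-(9 / 8) : ℝ))) := by
  rw [Real.div_rpow (by positivity) (by positivity), Real.mul_rpow (by norm_num) (by positivity),
    Real.div_rpow (by positivity) hq.le, ← sqrt_pow_nine hN, Real.sqrt_eq_rpow x,
    ← Real.rpow_mul hx.le, Real.rpow_neg hq.le, Real.rpow_neg hx.le]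
  norm_num
  field_simp

lemma sqrt_theta_pow_nine_le {N : ℕ} (hN : 1 ≤ N) {α : ℝ} (h0 : 0 ≤ α) (h1 : α < 1) :
    √‖theta N α‖ ^ 9 ≤ 2 ^ (5 / 4 : ℝ) * 2117 ^ (9 / 4 : ℝ) * (√(N : ℝ) ^ 5
      + ∑ q ∈ Finset.Icc 1 (8 * N), ∑ b ∈ Finset.range (2 * q + 1), √(N : ℝ) ^ 9 *
        ((q : ℝ) ^ (-(9 / 4) : ℝ) * (max 1 (N ^ 2 * |2 * α - b / q|)) ^ (-(9 / 8) : ℝ))) := by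
  obtain ⟨q, hq, b, hb, h⟩ := exists_normSq_theta_le hN h0 h1
  have hq0 : (0 : ℝ) < q := by exact_mod_cast (Finset.mem_Icc.1 hq).1
  have hN' : (1 : ℝ) ≤ N := by exact_mod_cast hN
  have hlog0 : 0 ≤ Real.log (8 * N) := Real.log_nonneg (by linarith)
  set B := 12 * ((N : ℝ) ^ 2 / q) / √(max 1 (N ^ 2 * |2 * α - b / q|)) with hB
  have hmax : (0 : ℝ) < max 1 (N ^ 2 * |2 * α - b / q|) := lt_of_lt_of_le one_pos (le_max_left _ _)
  have hBle : B ^ (9 / 4 : ℝ) ≤ 2117 ^ (9 / 4 : ℝ) * ∑ q ∈ Finset.Icc 1 (8 * N),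
      ∑ b ∈ Finset.range (2 * q + 1), √(N : ℝ) ^ 9 *
        ((q : ℝ) ^ (-(9 / 4) : ℝ) * (max 1 (N ^ 2 * |2 * α - b / q|)) ^ (-(9 / 8) : ℝ)) := by
    rw [hB, major_term_eq (by positivity) hq0 hmax]
    refine mul_le_mul (by gcongr; norm_num) ?_ (by positivity) (by positivity)
    refine le_trans ?_ (Finset.single_le_sum (f := fun q : ℕ => ∑ b ∈ Finset.range (2 * q + 1),
      √(N : ℝ) ^ 9 * ((q : ℝ) ^ (-(9 / 4) : ℝ)
        * (max 1 (N ^ 2 * |2 * α - b / q|)) ^ (-(9 / 8) : ℝ))) (fun _ _ => by positivity) hq)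
    exact Finset.single_le_sum (f := fun b : ℕ => √(N : ℝ) ^ 9 * ((q : ℝ) ^ (-(9 / 4) : ℝ)
        * (max 1 (N ^ 2 * |2 * α - b / q|)) ^ (-(9 / 8) : ℝ))) (fun _ _ => by positivity) hb
  have hA0 : 0 ≤ 29 * N * (1 + Real.log (8 * N)) := by positivity
  have hB0 : 0 ≤ B := by positivity
  have hadd : (29 * N * (1 + Real.log (8 * N)) + B) ^ (9 / 4 : ℝ) ≤ 2 ^ (9 / 4 - 1 : ℝ)
      * ((29 * N * (1 + Real.log (8 * N))) ^ (9 / 4 : ℝ) + B ^ (9 / 4 : ℝ)) := by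
    have := NNReal.rpow_add_le_mul_rpow_add_rpow ⟨_, hA0⟩ ⟨_, hB0⟩ (p := 9 / 4) (by norm_num)
    exact_mod_cast this
  rw [sqrt_pow_nine (norm_nonneg _)]
  calc (‖theta N α‖ ^ 2) ^ (9 / 4 : ℝ)
      ≤ (29 * N * (1 + Real.log (8 * N)) + B) ^ (9 / 4 : ℝ) := by gcongr
    _ ≤ _ := hadd
    _ ≤ _ := mul_le_mul_of_nonneg_left (add_le_add (minor_term_le hN) hBle) (by positivity)
    _ = _ := by
        rw [show (9 / 4 - 1 : ℝ) = 5 / 4 by norm_num]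
        ring

/-- The `9/2`-th moment of the quadratic Gauss sums has the size predicted by the major arcs. -/
lemma exists_sum_sqrt_gauss_le : ∃ C : ℝ, 0 ≤ C ∧ ∀ N P : ℕ, 1 ≤ N → P = N ^ 2 → ∀ [NeZero P],
    ∑ a : ZMod P, √‖gauss P N a‖ ^ 9 ≤ C * √(N : ℝ) ^ 9 := by
  obtain ⟨C, hC, h⟩ := exists_sum_max_rpow_le
  have hsum : Summable fun q : ℕ => (q : ℝ) ^ (-(5 / 4) : ℝ) :=
    Real.summable_nat_rpow.2 (by norm_num)
  set S := ∑' q : ℕ, (q : ℝ) ^ (-(5 / 4) : ℝ) with hS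
  have hS0 : 0 ≤ S := tsum_nonneg fun q => by positivity
  refine ⟨2 ^ (5 / 4 : ℝ) * 2117 ^ (9 / 4 : ℝ) * (1 + 3 * S * C), by positivity, ?_⟩
  intro N P hN hP _
  have hN' : (1 : ℝ) ≤ N := by exact_mod_cast hN
  have hPR : (P : ℝ) = N ^ 2 := by rw [hP]; push_cast; rfl
  have hP0 : (0 : ℝ) < P := by rw [hPR]; positivity
  have hval : ∑ a : ZMod P, √‖gauss P N a‖ ^ 9
      = ∑ a ∈ Finset.range P, √‖theta N (a / P)‖ ^ 9 := by
    refine Finset.sum_nbij' (fun z => z.val) (fun r => (r : ZMod P)) ?_ ?_ ?_ ?_ ?_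
    · intro z _; exact Finset.mem_range.2 z.val_lt
    · intro r _; exact Finset.mem_univ _
    · intro z _; exact ZMod.natCast_zmod_val z
    · intro r hr; exact ZMod.val_cast_of_lt (Finset.mem_range.1 hr)
    · intro z _; rw [gauss_eq_theta]
  have hinner : ∀ q ∈ Finset.Icc 1 (8 * N), ∑ b ∈ Finset.range (2 * q + 1), ∑ a ∈ Finset.range P,
      ((q : ℝ) ^ (-(9 / 4) : ℝ)
        * (max 1 (N ^ 2 * |2 * ((a : ℝ) / P) - b / q|)) ^ (-(9 / 8) : ℝ))
      ≤ 3 * C * (q : ℝ) ^ (-(5 / 4) : ℝ) := by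
    intro q hq
    have hq1 : (1 : ℝ) ≤ q := by exact_mod_cast (Finset.mem_Icc.1 hq).1
    have h1 : ∀ b ∈ Finset.range (2 * q + 1), ∑ a ∈ Finset.range P,
        ((q : ℝ) ^ (-(9 / 4) : ℝ)
          * (max 1 (N ^ 2 * |2 * ((a : ℝ) / P) - b / q|)) ^ (-(9 / 8) : ℝ))
        ≤ (q : ℝ) ^ (-(9 / 4) : ℝ) * C := by
      intro b _
      rw [← Finset.mul_sum]
      gcongr
      refine le_trans (le_of_eq (Finset.sum_congr rfl fun a _ => ?_)) (h P (P * (b / q)))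
      congr 2
      rw [← hPR]
      calc (P : ℝ) * |2 * ((a : ℝ) / P) - b / q| = |(P : ℝ) * (2 * ((a : ℝ) / P) - b / q)| := by
            rw [abs_mul, abs_of_pos hP0]
        _ = _ := by
            congr 1
            field_simp
    refine (Finset.sum_le_sum h1).trans ?_
    rw [Finset.sum_const, Finset.card_range, nsmul_eq_mul]
    have h2 : (q : ℝ) ^ (-(5 / 4) : ℝ) = q * (q : ℝ) ^ (-(9 / 4) : ℝ) := by
      rw [← Real.rpow_one_add' (by positivity) (by norm_num)]
      norm_num
    rw [h2]
    push_cast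
    have h3 : 0 ≤ (q : ℝ) ^ (-(9 / 4) : ℝ) * C := by positivity
    nlinarith
  rw [hval]
  have hpoint : ∀ a ∈ Finset.range P, _ := fun a ha =>
    sqrt_theta_pow_nine_le hN (α := (a : ℝ) / P) (by positivity)
      (by rw [div_lt_one hP0]; exact_mod_cast Finset.mem_range.1 ha)
  refine (Finset.sum_le_sum hpoint).trans ?_
  rw [← Finset.mul_sum, mul_assoc _ (1 + 3 * S * C)]
  gcongr
  rw [Finset.sum_add_distrib, Finset.sum_const, Finset.card_range, nsmul_eq_mul, add_mul]
  refine add_le_add (le_of_eq ?_) ?_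
  · have : √(N : ℝ) ^ 4 = N ^ 2 := by
      rw [show √(N : ℝ) ^ 4 = (√(N : ℝ) ^ 2) ^ 2 by ring, Real.sq_sqrt (by positivity)]
    rw [hPR, ← this]
    ring
  · rw [Finset.sum_comm]
    calc ∑ q ∈ Finset.Icc 1 (8 * N), ∑ a ∈ Finset.range P,
          ∑ b ∈ Finset.range (2 * q + 1), √(N : ℝ) ^ 9 * ((q : ℝ) ^ (-(9 / 4) : ℝ)
            * (max 1 (N ^ 2 * |2 * ((a : ℝ) / P) - b / q|)) ^ (-(9 / 8) : ℝ))
      _ = √(N : ℝ) ^ 9 * ∑ q ∈ Finset.Icc 1 (8 * N), ∑ b ∈ Finset.range (2 * q + 1),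
        ∑ a ∈ Finset.range P, ((q : ℝ) ^ (-(9 / 4) : ℝ)
          * (max 1 (N ^ 2 * |2 * ((a : ℝ) / P) - b / q|)) ^ (-(9 / 8) : ℝ)) := by
          rw [Finset.mul_sum]
          refine Finset.sum_congr rfl fun q _ => ?_
          rw [Finset.sum_comm, Finset.mul_sum]
          refine Finset.sum_congr rfl fun a _ => ?_
          simp only [Finset.mul_sum]
      _ ≤ √(N : ℝ) ^ 9 * ∑ q ∈ Finset.Icc 1 (8 * N), 3 * C * (q : ℝ) ^ (-(5 / 4) : ℝ) := by
          gcongr with q hq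
          exact hinner q hq
      _ ≤ √(N : ℝ) ^ 9 * (3 * C * S) := by
          rw [← Finset.mul_sum]
          gcongr
          exact hsum.sum_le_tsum _ fun q _ => by positivity
      _ = _ := by ring

lemma norm_gauss_le {P N : ℕ} [NeZero P] (hN : 1 ≤ N) (a : ZMod P) : ‖gauss P N a‖ ≤ 3 * N := by
  refine (norm_sum_le _ _).trans ?_
  simp only [norm_stdAddChar, Finset.sum_const, nsmul_eq_mul, mul_one, Int.card_Icc]
  exact_mod_cast (by omega : (((N : ℤ) + 1 - -(N : ℤ)).toNat) ≤ 3 * N)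

lemma exists_sum_sqrt_gauss_pow_le (j : ℕ) : ∃ C : ℝ, 0 ≤ C ∧
    ∀ N P : ℕ, 1 ≤ N → P = N ^ 2 → ∀ [NeZero P],
    ∑ a : ZMod P, √‖gauss P N a‖ ^ (j + 9) ≤ C * √(N : ℝ) ^ (j + 9) := by
  obtain ⟨C, hC, h⟩ := exists_sum_sqrt_gauss_le
  refine ⟨√3 ^ j * C, by positivity, fun N P hN hP _ => ?_⟩
  have hterm : ∀ a : ZMod P, √‖gauss P N a‖ ^ (j + 9)
      ≤ (√3 * √(N : ℝ)) ^ j * √‖gauss P N a‖ ^ 9 := by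
    intro a
    rw [pow_add]
    gcongr
    rw [← Real.sqrt_mul (by norm_num)]
    exact Real.sqrt_le_sqrt (norm_gauss_le hN a)
  refine (Finset.sum_le_sum fun a _ => hterm a).trans ?_
  rw [← Finset.mul_sum]
  calc (√3 * √(N : ℝ)) ^ j * ∑ a : ZMod P, √‖gauss P N a‖ ^ 9
      ≤ (√3 * √(N : ℝ)) ^ j * (C * √(N : ℝ) ^ 9) := by gcongr; exact h N P hN hP
    _ = _ := by rw [mul_pow, pow_add]; ring

lemma sqrt_add_one_le {n : ℕ} (hn : 1 ≤ n) : ((Nat.sqrt n + 1 : ℕ) : ℝ) ≤ 2 * √(n : ℝ) := by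
  have h1 : ((Nat.sqrt n : ℕ) : ℝ) ≤ √(n : ℝ) := Real.nat_sqrt_le_real_sqrt
  have h2 : (1 : ℝ) ≤ √(n : ℝ) := Real.one_le_sqrt.2 (by exact_mod_cast hn)
  push_cast
  linarith

/-- In at least five variables the number of representations has the expected order. -/
lemma exists_rep_le (e : ℕ) : ∃ C : ℝ, 0 ≤ C ∧ ∀ n m : ℕ, 1 ≤ n → m ≤ n →
    (rep (e + 5) m : ℝ) ≤ C * √(n : ℝ) ^ (e + 3) := by
  obtain ⟨C, hC, h⟩ := exists_sum_sqrt_gauss_pow_le (2 * e + 1)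
  refine ⟨C * 2 ^ (e + 3), by positivity, fun n m hn hmn => ?_⟩
  set N := Nat.sqrt n + 1 with hNdef
  have hN : 1 ≤ N := by omega
  have hN0 : (0 : ℝ) < N := by exact_mod_cast hN
  have hn2 : n < N * N := Nat.lt_succ_sqrt n
  have : NeZero (N ^ 2) := ⟨by positivity⟩
  have h1 := mul_modRep_le (N ^ 2) N (e + 5) m
  have h2 := h N (N ^ 2) hN rfl
  have h3 : rep (e + 5) (m : ℤ) ≤ modRep (N ^ 2) N (e + 5) ((m : ℤ) : ZMod (N ^ 2)) :=
    rep_le_modRep _ (by omega) _ (by exact_mod_cast (show m ≤ N ^ 2 by nlinarith))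
  have h4 : ∑ a, ‖gauss (N ^ 2) N a‖ ^ (e + 5)
      = ∑ a, √‖gauss (N ^ 2) N a‖ ^ (2 * e + 1 + 9) := by
    refine Finset.sum_congr rfl fun a _ => ?_
    rw [show 2 * e + 1 + 9 = 2 * (e + 5) by ring, pow_mul, Real.sq_sqrt (norm_nonneg _)]
  have h5 : √(N : ℝ) ^ (2 * e + 1 + 9) = N ^ 2 * N ^ (e + 3) := by
    rw [show 2 * e + 1 + 9 = 2 * (e + 5) by ring, pow_mul, Real.sq_sqrt hN0.le]
    ring
  rw [h4] at h1
  rw [h5] at h2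
  have h6 : (modRep (N ^ 2) N (e + 5) (m : ZMod (N ^ 2)) : ℝ) ≤ C * N ^ (e + 3) := by
    refine le_of_mul_le_mul_left ?_ (show (0 : ℝ) < N ^ 2 by positivity)
    have := h1.trans h2
    push_cast at this
    linarith
  calc (rep (e + 5) m : ℝ) ≤ modRep (N ^ 2) N (e + 5) (m : ZMod (N ^ 2)) := by
        exact_mod_cast h3
    _ ≤ C * N ^ (e + 3) := h6
    _ ≤ C * (2 * √(n : ℝ)) ^ (e + 3) := by gcongr; exact sqrt_add_one_le hn
    _ = _ := by ring

/-- The third moment of the number of representations has the expected order, from three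
variables on. -/
lemma exists_sum_rep_cube_le (e : ℕ) : ∃ C : ℝ, 0 ≤ C ∧ ∀ n : ℕ, 1 ≤ n →
    ∑ m ∈ Finset.range (n + 1), (rep (e + 3) m : ℝ) ^ 3 ≤ C * √(n : ℝ) ^ (3 * e + 5) := by
  obtain ⟨C, hC, h⟩ := exists_sum_sqrt_gauss_pow_le (3 * e)
  refine ⟨C ^ 2 * 2 ^ (3 * e + 5), by positivity, fun n hn => ?_⟩
  set N := Nat.sqrt n + 1 with hNdef
  have hN : 1 ≤ N := by omega
  have hN0 : (0 : ℝ) < N := by exact_mod_cast hN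
  have hn2 : n < N * N := Nat.lt_succ_sqrt n
  have : NeZero (N ^ 2) := ⟨by positivity⟩
  have h1 := sum_modRep_cube_le (N ^ 2) N (e + 3)
  have h2 := h N (N ^ 2) hN rfl
  have h3 : ∑ m ∈ Finset.range (n + 1), (rep (e + 3) m : ℝ) ^ 3
      ≤ ∑ z, (modRep (N ^ 2) N (e + 3) z : ℝ) ^ 3 := by
    have h4 : ∀ m ∈ Finset.range (n + 1), (rep (e + 3) m : ℝ) ^ 3
        ≤ (modRep (N ^ 2) N (e + 3) (m : ZMod (N ^ 2)) : ℝ) ^ 3 := by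
      intro m hm
      rw [Finset.mem_range] at hm
      have h5 : rep (e + 3) (m : ℤ) ≤ modRep (N ^ 2) N (e + 3) ((m : ℤ) : ZMod (N ^ 2)) :=
        rep_le_modRep _ (by omega) _ (by exact_mod_cast (show m ≤ N ^ 2 by nlinarith))
      rw [Int.cast_natCast] at h5
      gcongr
    refine (Finset.sum_le_sum h4).trans ?_
    rw [← Finset.sum_image (f := fun z => (modRep (N ^ 2) N (e + 3) z : ℝ) ^ 3)
      (g := fun m : ℕ => (m : ZMod (N ^ 2)))]
    · exact Finset.sum_le_sum_of_subset_of_nonneg (Finset.subset_univ _) fun _ _ _ => by positivity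
    · intro a ha b hb hab
      rw [Finset.mem_coe, Finset.mem_range] at ha hb
      have ha' : a < N ^ 2 := by rw [sq]; omega
      have hb' : b < N ^ 2 := by rw [sq]; omega
      have := congrArg ZMod.val hab
      simpa only [ZMod.val_cast_of_lt ha', ZMod.val_cast_of_lt hb'] using this
  refine h3.trans ?_
  rw [show 3 * (e + 3) = 3 * e + 9 by ring] at h1
  have h4 : (√(N : ℝ) ^ (3 * e + 9)) ^ 2 = N ^ 4 * N ^ (3 * e + 5) := by
    rw [← pow_mul, mul_comm, pow_mul, Real.sq_sqrt hN0.le]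
    ring
  have h5 : ∑ z, (modRep (N ^ 2) N (e + 3) z : ℝ) ^ 3 ≤ C ^ 2 * N ^ (3 * e + 5) := by
    refine le_of_mul_le_mul_left ?_ (show (0 : ℝ) < N ^ 4 by positivity)
    have h6 : (∑ a : ZMod (N ^ 2), √‖gauss (N ^ 2) N a‖ ^ (3 * e + 9)) ^ 2
        ≤ (C * √(N : ℝ) ^ (3 * e + 9)) ^ 2 := by gcongr
    rw [mul_pow, h4] at h6
    have := h1.trans h6
    push_cast at this
    rw [← pow_mul, show 2 * 2 = 4 from rfl] at this
    linarith
  calc _ ≤ C ^ 2 * (N : ℝ) ^ (3 * e + 5) := h5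
    _ ≤ C ^ 2 * (2 * √(n : ℝ)) ^ (3 * e + 5) := by gcongr; exact sqrt_add_one_le hn
    _ = _ := by ring

/-- The lattice points of the cube `[-n, n]^d`. -/
def cube (d n : ℕ) : Finset (Fin d → ℤ) := Finset.Icc (fun _ => -(n : ℤ)) (fun _ => (n : ℤ))

lemma mem_cube {d n : ℕ} {u : Fin d → ℤ} : u ∈ cube d n ↔ ∀ i, |u i| ≤ n := by
  simp only [cube, Finset.mem_Icc, Pi.le_def, abs_le, forall_and]

lemma card_cube (d n : ℕ) : (cube d n).card = (2 * n + 1) ^ d := by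
  simp only [cube, Pi.card_Icc, Int.card_Icc, Finset.prod_const, Finset.card_univ,
    Fintype.card_fin]
  congr 1
  omega

lemma sub_mem_cube_iff {d n : ℕ} {x y : Fin d → ℤ} :
    x - y ∈ cube d n ↔ y ∈ Metric.closedBall x (n : ℝ) := by
  rw [mem_cube, Metric.mem_closedBall, dist_comm, dist_pi_le_iff (Nat.cast_nonneg n)]
  refine forall_congr' fun i => ?_
  rw [Int.dist_eq, Pi.sub_apply]
  exact_mod_cast Iff.rfl

lemma sum_cube_sub {d : ℕ} (n : ℕ) (F : (Fin d → ℤ) → ℝ≥0∞) (x : Fin d → ℤ) :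
    ∑ u ∈ cube d n, F (x - u) = ∑' y, if x - y ∈ cube d n then F y else 0 := by
  rw [← (Equiv.subLeft x).tsum_eq, tsum_eq_sum (s := cube d n)]
  · exact Finset.sum_congr rfl fun u hu => by simp [hu]
  · intro u hu
    simp [hu]

/-- The discrete Hardy-Littlewood maximal function over centred cubes. -/
def cubeMax {d : ℕ} (F : (Fin d → ℤ) → ℝ≥0∞) (x : Fin d → ℤ) : ℝ≥0∞ :=
  ⨆ n : ℕ, ((2 * n + 1 : ℝ≥0∞) ^ d)⁻¹ * ∑ u ∈ cube d n, F (x - u)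

lemma sum_cube_le_cubeMax {d : ℕ} (F : (Fin d → ℤ) → ℝ≥0∞) (x : Fin d → ℤ) (n : ℕ) :
    ∑ u ∈ cube d n, F (x - u) ≤ (2 * n + 1) ^ d * cubeMax F x := by
  have h : ((2 * n + 1 : ℝ≥0∞) ^ d) ≠ 0 := by positivity
  have h' : ((2 * n + 1 : ℝ≥0∞) ^ d) ≠ ⊤ := by finiteness
  calc ∑ u ∈ cube d n, F (x - u)
      = (2 * n + 1) ^ d * (((2 * n + 1 : ℝ≥0∞) ^ d)⁻¹ * ∑ u ∈ cube d n, F (x - u)) := by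
        rw [← mul_assoc, ENNReal.mul_inv_cancel h h', one_mul]
    _ ≤ _ := by
        gcongr
        exact le_iSup (fun n : ℕ => ((2 * n + 1 : ℝ≥0∞) ^ d)⁻¹ * ∑ u ∈ cube d n, F (x - u)) n

lemma lt_cubeMax_iff {d : ℕ} {F : (Fin d → ℤ) → ℝ≥0∞} {x : Fin d → ℤ} {t : ℝ≥0∞} :
    t < cubeMax F x ↔ ∃ n : ℕ, t * (2 * n + 1) ^ d < ∑ u ∈ cube d n, F (x - u) := by
  rw [cubeMax, lt_iSup_iff]
  refine exists_congr fun n => ?_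
  rw [mul_comm _ (Finset.sum _ _), ← div_eq_mul_inv, ENNReal.lt_div_iff_mul_lt]
  · left; positivity
  · left; finiteness

/-- The weak-type `(1,1)` inequality for the discrete Hardy-Littlewood maximal function. -/
lemma tsum_lt_cubeMax_le {d : ℕ} (hd : d ≠ 0) (F : (Fin d → ℤ) → ℝ≥0∞) {t : ℝ≥0∞} (ht : t ≠ 0)
    (ht' : t ≠ ⊤) :
    t * ∑' x, (if t < cubeMax F x then 1 else 0) ≤ 5 ^ d * ∑' x, F x := by
  rcases eq_or_ne (∑' x, F x) ⊤ with hF | hF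
  · rw [hF, ENNReal.mul_top (by positivity)]
    exact le_top
  set S := ∑' x, F x
  have h1 : ∀ x : {x // t < cubeMax F x}, ∃ n : ℕ,
      t * (2 * n + 1) ^ d < ∑ u ∈ cube d n, F (x - u) := fun x => lt_cubeMax_iff.1 x.2
  choose r hr using h1
  have hS : ∀ (n : ℕ) x, ∑ u ∈ cube d n, F (x - u) ≤ S := by
    intro n x
    rw [sum_cube_sub]
    exact ENNReal.tsum_le_tsum fun y => by split_ifs <;> simp
  have hR : ∀ x, (r x : ℝ) ≤ (S / t).toReal := by
    intro x
    have hfin : S / t ≠ ⊤ := ENNReal.div_ne_top hF ht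
    have h2 : ((r x : ℕ) : ℝ≥0∞) ≤ S / t := by
      rw [ENNReal.le_div_iff_mul_le (Or.inl ht) (Or.inl ht')]
      calc (r x : ℝ≥0∞) * t ≤ (2 * r x + 1) ^ d * t := by
            gcongr
            have : r x ≤ (2 * r x + 1) ^ d :=
              (show r x ≤ 2 * r x + 1 by omega).trans (Nat.le_self_pow hd _)
            exact_mod_cast this
        _ = t * (2 * r x + 1) ^ d := mul_comm _ _
        _ ≤ S := (hr x).le.trans (hS _ _)
    simpa using ENNReal.toReal_mono hfin h2
  obtain ⟨u, -, hdisj, hcov⟩ := Vitali.exists_disjoint_subfamily_covering_enlargement_closedBall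
    Set.univ (fun x : {x // t < cubeMax F x} => (x : Fin d → ℤ)) (fun x => (r x : ℝ))
    (S / t).toReal (fun x _ => hR x) 5 (by norm_num)
  have h2 : ∀ x, (if t < cubeMax F x then (1 : ℝ≥0∞) else 0)
      ≤ ∑' b : u, if (b : Fin d → ℤ) - x ∈ cube d (5 * r b) then 1 else 0 := by
    intro x
    split_ifs with hx
    · obtain ⟨b, hb, hsub⟩ := hcov ⟨x, hx⟩ trivial
      refine le_trans (le_of_eq ?_) (ENNReal.le_tsum (⟨b, hb⟩ : u))
      rw [if_pos]
      rw [sub_mem_cube_iff]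
      push_cast
      exact hsub (Metric.mem_closedBall_self (Nat.cast_nonneg _))
    · exact zero_le
  have h3 : ∀ b : u, t * ∑' x, (if (b : Fin d → ℤ) - x ∈ cube d (5 * r b) then (1 : ℝ≥0∞) else 0)
      ≤ 5 ^ d * ∑' y, if (b : Fin d → ℤ) - y ∈ cube d (r b) then F y else 0 := by
    intro b
    rw [← sum_cube_sub _ (fun _ => 1), ← sum_cube_sub, Finset.sum_const, card_cube, nsmul_one]
    calc t * (((2 * (5 * r b) + 1) ^ d : ℕ) : ℝ≥0∞) ≤ t * (5 * (2 * r b + 1)) ^ d := by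
          gcongr
          exact_mod_cast Nat.pow_le_pow_left (by omega) d
      _ = 5 ^ d * (t * (2 * r b + 1) ^ d) := by rw [mul_pow]; ring
      _ ≤ _ := by gcongr; exact (hr b).le
  calc t * ∑' x, (if t < cubeMax F x then 1 else 0)
      ≤ t * ∑' x, ∑' b : u, (if (b : Fin d → ℤ) - x ∈ cube d (5 * r b) then 1 else 0) := by
        gcongr with x; exact h2 x
    _ = ∑' b : u, t * ∑' x, (if (b : Fin d → ℤ) - x ∈ cube d (5 * r b) then 1 else 0) := by
        rw [ENNReal.tsum_comm, ENNReal.tsum_mul_left]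
    _ ≤ ∑' b : u, 5 ^ d * ∑' y, (if (b : Fin d → ℤ) - y ∈ cube d (r b) then F y else 0) :=
        ENNReal.tsum_le_tsum h3
    _ = 5 ^ d * ∑' y, ∑' b : u, (if (b : Fin d → ℤ) - y ∈ cube d (r b) then F y else 0) := by
        rw [ENNReal.tsum_mul_left, ENNReal.tsum_comm]
    _ ≤ 5 ^ d * ∑' y, F y := by
        gcongr with y
        by_cases hy : ∃ b : u, (b : Fin d → ℤ) - y ∈ cube d (r b)
        · obtain ⟨b, hb⟩ := hy
          rw [tsum_eq_single b]
          · rw [if_pos hb]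
          · intro c hc
            rw [if_neg]
            intro hc'
            rw [sub_mem_cube_iff] at hb hc'
            exact Set.disjoint_left.1 (hdisj c.2 b.2 fun h => hc (Subtype.ext h)) hc' hb
        · rw [not_exists] at hy
          simp [hy]

lemma tsum_zpow_lt_le {q : ℝ} (hq : 0 < q) : ∃ C : ℝ≥0∞, C ≠ ⊤ ∧ ∀ b : ℝ≥0∞,
    ∑' k : ℤ, (if (2 : ℝ≥0∞) ^ k < b then ((2 : ℝ≥0∞) ^ k) ^ q else 0) ≤ C * b ^ q := by
  have hlt : ((2 : ℝ≥0∞) ^ q)⁻¹ < 1 :=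
    ENNReal.inv_lt_one.2 (ENNReal.one_lt_rpow (by norm_num) hq)
  refine ⟨(1 - ((2 : ℝ≥0∞) ^ q)⁻¹)⁻¹, ?_, fun b => ?_⟩
  · exact ENNReal.inv_ne_top.2 (tsub_pos_of_lt hlt).ne'
  rcases eq_or_ne b 0 with rfl | hb
  · simp
  rcases eq_or_ne b ⊤ with rfl | hb'
  · rw [ENNReal.top_rpow_of_pos hq, ENNReal.mul_top]
    · exact le_top
    · exact ENNReal.inv_ne_zero.2 (by finiteness)
  obtain ⟨K, hK, hK'⟩ := ENNReal.exists_mem_Ioc_zpow hb hb' (y := 2) (by norm_num) (by norm_num)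
  have hinj : Function.Injective fun j : ℕ => K - (j : ℤ) := fun a b h => by
    simpa using h
  rw [← hinj.tsum_eq, ← ENNReal.tsum_geometric, ← ENNReal.tsum_mul_right]
  · refine ENNReal.tsum_le_tsum fun j => ?_
    have h1 : ((2 : ℝ≥0∞) ^ (K - (j : ℤ))) ^ q
        = (((2 : ℝ≥0∞) ^ q)⁻¹) ^ j * ((2 : ℝ≥0∞) ^ K) ^ q := by
      rw [ENNReal.zpow_sub (by norm_num) (by norm_num), ENNReal.mul_rpow_of_nonneg _ _ hq.le,
        zpow_natCast, ENNReal.inv_rpow, ← ENNReal.rpow_natCast, ← ENNReal.rpow_natCast,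
        ENNReal.inv_rpow, ← ENNReal.rpow_mul, ← ENNReal.rpow_mul, mul_comm, mul_comm q]
    split_ifs
    · rw [h1]; gcongr
    · exact zero_le
  · intro k hk
    rw [Function.mem_support, ne_eq, ite_eq_right_iff, Classical.not_imp] at hk
    have : k < K + 1 := by
      by_contra hcon
      exact absurd (hk.1.trans_le hK')
        (not_lt.2 (ENNReal.zpow_le_of_le (by norm_num) (by omega)))
    exact ⟨(K - k).toNat, by simp; omega⟩

lemma rpow_le_tsum_zpow {p : ℝ} (hp : 0 < p) (a : ℝ≥0∞) :
    a ^ p ≤ 2 ^ p * ∑' k : ℤ, (if (2 : ℝ≥0∞) ^ k < a then ((2 : ℝ≥0∞) ^ k) ^ p else 0) := by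
  rcases eq_or_ne a 0 with rfl | ha
  · simp [ENNReal.zero_rpow_of_pos hp]
  rcases eq_or_ne a ⊤ with rfl | ha'
  · have : ∑' k : ℤ, (if (2 : ℝ≥0∞) ^ k < ⊤ then ((2 : ℝ≥0∞) ^ k) ^ p else 0) = ⊤ := by
      rw [eq_top_iff]
      have hinj : Function.Injective fun j : ℕ => (j : ℤ) := Nat.cast_injective
      calc (⊤ : ℝ≥0∞) = ∑' j : ℕ, (1 : ℝ≥0∞) := by
            rw [ENNReal.tsum_const_eq_top_of_ne_zero one_ne_zero]
        _ ≤ ∑' j : ℕ, (if (2 : ℝ≥0∞) ^ (j : ℤ) < ⊤ then ((2 : ℝ≥0∞) ^ (j : ℤ)) ^ p else 0) := by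
          refine ENNReal.tsum_le_tsum fun j => ?_
          rw [if_pos (by rw [zpow_natCast]; finiteness)]
          rw [zpow_natCast]
          exact ENNReal.one_le_rpow (one_le_pow₀ (by norm_num)) hp
        _ ≤ _ := ENNReal.tsum_comp_le_tsum_of_injective hinj
            (fun k : ℤ => if (2 : ℝ≥0∞) ^ k < ⊤ then ((2 : ℝ≥0∞) ^ k) ^ p else 0)
    rw [this, ENNReal.mul_top]
    · exact le_top
    · positivity
  obtain ⟨K, hK, hK'⟩ := ENNReal.exists_mem_Ioc_zpow ha ha' (y := 2) (by norm_num) (by norm_num)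
  calc a ^ p ≤ (2 ^ (K + 1)) ^ p := by gcongr
    _ = 2 ^ p * ((2 : ℝ≥0∞) ^ K) ^ p := by
      rw [ENNReal.zpow_add (by norm_num) (by norm_num), zpow_one,
        ENNReal.mul_rpow_of_nonneg _ _ hp.le, mul_comm]
    _ ≤ _ := by
      gcongr
      refine le_trans (le_of_eq ?_) (ENNReal.le_tsum K)
      rw [if_pos hK]

lemma cubeMax_le_add {d : ℕ} (F G : (Fin d → ℤ) → ℝ≥0∞) (c : ℝ≥0∞) (h : ∀ x, F x ≤ G x + c)
    (x : Fin d → ℤ) : cubeMax F x ≤ cubeMax G x + c := by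
  refine iSup_le fun n => ?_
  have h0 : ((2 * n + 1 : ℝ≥0∞) ^ d) ≠ 0 := by positivity
  have h' : ((2 * n + 1 : ℝ≥0∞) ^ d) ≠ ⊤ := by finiteness
  calc ((2 * n + 1 : ℝ≥0∞) ^ d)⁻¹ * ∑ u ∈ cube d n, F (x - u)
      ≤ ((2 * n + 1 : ℝ≥0∞) ^ d)⁻¹ * ∑ u ∈ cube d n, (G (x - u) + c) := by
        gcongr; exact h _
    _ = ((2 * n + 1 : ℝ≥0∞) ^ d)⁻¹ * ∑ u ∈ cube d n, G (x - u) + c := by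
        rw [Finset.sum_add_distrib, mul_add, Finset.sum_const, card_cube, nsmul_eq_mul]
        push_cast
        rw [← mul_assoc, ENNReal.inv_mul_cancel h0 h', one_mul]
    _ ≤ _ := by
        gcongr
        exact le_iSup (fun n : ℕ => ((2 * n + 1 : ℝ≥0∞) ^ d)⁻¹ * ∑ u ∈ cube d n, G (x - u)) n

/-- The discrete Hardy-Littlewood maximal function is bounded on `l^p` for `p > 1`. -/
theorem exists_tsum_cubeMax_rpow_le {d : ℕ} (hd : d ≠ 0) {p : ℝ} (hp : 1 < p) :
    ∃ C : ℝ≥0∞, C ≠ ⊤ ∧ ∀ F : (Fin d → ℤ) → ℝ≥0∞,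
      ∑' x, cubeMax F x ^ p ≤ C * ∑' x, F x ^ p := by
  obtain ⟨C, hC, hsum⟩ := tsum_zpow_lt_le (q := p - 1) (by linarith)
  refine ⟨2 ^ p * (2 * 5 ^ d * (C * 2 ^ (p - 1))), by finiteness, fun F => ?_⟩
  have hp0 : 0 < p := by linarith
  have h1 : ∀ k : ℤ, ∑' x, (if (2 : ℝ≥0∞) ^ k < cubeMax F x then ((2 : ℝ≥0∞) ^ k) ^ p else 0)
      ≤ 2 * 5 ^ d * ∑' x, if (2 : ℝ≥0∞) ^ k < 2 * F x then
        F x * ((2 : ℝ≥0∞) ^ k) ^ (p - 1) else 0 := by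
    intro k
    set s : ℝ≥0∞ := 2 ^ k
    have hs : s ≠ 0 := (ENNReal.zpow_pos (by norm_num) (by norm_num) k).ne'
    have hs' : s ≠ ⊤ := ENNReal.zpow_ne_top (by norm_num) (by norm_num) k
    set G : (Fin d → ℤ) → ℝ≥0∞ := fun x => if s < 2 * F x then F x else 0
    have hFG : ∀ x, F x ≤ G x + s / 2 := by
      intro x
      by_cases hx : s < 2 * F x
      · simp [G, hx]
      · simp only [G, hx, if_false, zero_add]
        rw [ENNReal.le_div_iff_mul_le (by simp) (by simp), mul_comm]
        exact not_lt.1 hx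
    have hw := tsum_lt_cubeMax_le hd G (t := s / 2) (by simpa using hs)
      (ENNReal.div_ne_top hs' (by norm_num))
    have hsp : s ^ p = s ^ (p - 1) * s := by
      conv_rhs => rw [← ENNReal.rpow_one s, ← ENNReal.rpow_mul, one_mul]
      rw [← ENNReal.rpow_add _ _ hs hs', sub_add_cancel]
    calc ∑' x, (if s < cubeMax F x then s ^ p else 0)
        ≤ ∑' x, s ^ p * (if s / 2 < cubeMax G x then 1 else 0) := by
          refine ENNReal.tsum_le_tsum fun x => ?_
          split_ifs with hx hx'
          · simp
          · exfalso
            refine absurd (hx.trans_le ((cubeMax_le_add F G _ hFG x).trans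
              (add_le_add_left (not_lt.1 hx') _))) ?_
            rw [ENNReal.add_halves]
            exact lt_irrefl _
          · simp
          · simp
      _ = 2 * s ^ (p - 1) * (s / 2 * ∑' x, (if s / 2 < cubeMax G x then 1 else 0)) := by
          rw [ENNReal.tsum_mul_left, hsp]
          have : s = 2 * (s / 2) := (ENNReal.mul_div_cancel (by norm_num) (by norm_num)).symm
          conv_lhs => rw [mul_assoc]; arg 2; arg 1; rw [this]
          ring
      _ ≤ 2 * s ^ (p - 1) * (5 ^ d * ∑' x, G x) := by gcongr
      _ = 2 * 5 ^ d * ∑' x, s ^ (p - 1) * G x := by rw [ENNReal.tsum_mul_left]; ring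
      _ = _ := by
          congr 2
          ext x
          simp only [G]
          split_ifs <;> ring
  calc ∑' x, cubeMax F x ^ p
      ≤ ∑' x, 2 ^ p * ∑' k : ℤ,
        (if (2 : ℝ≥0∞) ^ k < cubeMax F x then ((2 : ℝ≥0∞) ^ k) ^ p else 0) :=
        ENNReal.tsum_le_tsum fun x => rpow_le_tsum_zpow hp0 _
    _ = 2 ^ p * ∑' k : ℤ, ∑' x,
        (if (2 : ℝ≥0∞) ^ k < cubeMax F x then ((2 : ℝ≥0∞) ^ k) ^ p else 0) := by
        rw [ENNReal.tsum_mul_left, ENNReal.tsum_comm]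
    _ ≤ 2 ^ p * ∑' k : ℤ, 2 * 5 ^ d * ∑' x, (if (2 : ℝ≥0∞) ^ k < 2 * F x then
        F x * ((2 : ℝ≥0∞) ^ k) ^ (p - 1) else 0) := by
        gcongr with k; exact h1 k
    _ = 2 ^ p * (2 * 5 ^ d * ∑' x, F x * ∑' k : ℤ, (if (2 : ℝ≥0∞) ^ k < 2 * F x then
        ((2 : ℝ≥0∞) ^ k) ^ (p - 1) else 0)) := by
        rw [ENNReal.tsum_mul_left, ENNReal.tsum_comm]
        simp only [← ENNReal.tsum_mul_left, mul_ite, mul_zero]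
    _ ≤ 2 ^ p * (2 * 5 ^ d * ∑' x, F x * (C * (2 * F x) ^ (p - 1))) := by
        gcongr with x; exact hsum _
    _ = 2 ^ p * (2 * 5 ^ d * (C * 2 ^ (p - 1))) * ∑' x, F x ^ p := by
        rw [mul_assoc (2 ^ p), mul_assoc (2 * 5 ^ d), ← ENNReal.tsum_mul_left (a := C * _)]
        congr 3
        ext x
        have : F x ^ p = F x * F x ^ (p - 1) := by
          conv_rhs => arg 1; rw [← ENNReal.rpow_one (F x)]
          rw [← ENNReal.rpow_add_of_nonneg _ _ (by norm_num) (by linarith), add_sub_cancel]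
        rw [this, ENNReal.mul_rpow_of_nonneg _ _ (by linarith)]
        ring

lemma tsum_sph (d lam : ℕ) (G : V d → ℝ≥0∞) :
    ∑' uv : sph d lam, G uv.1.1 = ∑' u, rep d (lam - ∑ i, u i ^ 2) * G u := by
  rw [tsum_subtype (sph d lam) fun uv : V d × V d => G uv.1, ENNReal.tsum_prod']
  refine tsum_congr fun u => ?_
  rw [← tsum_sphere, ← ENNReal.tsum_mul_right]
  refine tsum_congr fun v => ?_
  have h : (u, v) ∈ sph d lam ↔ ∑ i, v i ^ 2 = (lam : ℤ) - ∑ i, u i ^ 2 := by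
    rw [sph, Set.mem_ofPred_eq, eq_sub_iff_add_eq, add_comm]
  classical
  rw [Set.indicator_apply, ite_mul, one_mul, zero_mul]
  simp only [h]

lemma Ncount_eq_rep {d lam : ℕ} (h : 0 < Ncount d lam) : Ncount d lam = rep (d + d) lam := by
  have : Finite (sph d lam) := Nat.finite_of_card_ne_zero h.ne'
  have : Fintype (sph d lam) := Fintype.ofFinite _
  have h1 := tsum_sph d lam fun _ => 1
  simp only [mul_one] at h1
  rw [tsum_rep, tsum_fintype, Finset.sum_const, nsmul_one, Finset.card_univ] at h1
  rw [Ncount, Nat.card_eq_fintype_card]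
  exact_mod_cast h1

lemma rep_sub_eq_zero {d lam k : ℕ} {u : Fin d → ℤ} (hu : u ∉ cube d (Nat.sqrt lam)) :
    rep k (lam - ∑ i, u i ^ 2) = 0 := by
  rw [mem_cube] at hu
  push Not at hu
  obtain ⟨i, hi⟩ := hu
  refine rep_neg _ ?_
  have h1 : u i ^ 2 ≤ ∑ i, u i ^ 2 :=
    Finset.single_le_sum (f := fun i => u i ^ 2) (fun _ _ => sq_nonneg _) (Finset.mem_univ i)
  have h2 : lam < (Nat.sqrt lam + 1) * (Nat.sqrt lam + 1) := Nat.lt_succ_sqrt lam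
  have h3 : (lam : ℤ) < (Nat.sqrt lam + 1) * (Nat.sqrt lam + 1) := by exact_mod_cast h2
  have h4 : ((Nat.sqrt lam : ℤ) + 1) ^ 2 ≤ u i ^ 2 := by
    rw [← sq_abs (u i)]
    exact pow_le_pow_left₀ (by positivity) (by omega) 2
  linarith [sq ((Nat.sqrt lam : ℤ) + 1)]

lemma enorm_avg0_le {d lam : ℕ} (h : 0 < Ncount d lam) (f : V d → ℂ) (x : V d) :
    (‖avg0 d lam f x‖₊ : ℝ≥0∞) ≤ (rep (d + d) lam : ℝ≥0∞)⁻¹ *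
      ∑ u ∈ cube d (Nat.sqrt lam), rep d (lam - ∑ i, u i ^ 2) * (‖f (x - u)‖₊ : ℝ≥0∞) := by
  have hfin : Finite (sph d lam) := Nat.finite_of_card_ne_zero h.ne'
  have : Fintype (sph d lam) := Fintype.ofFinite _
  have h1 := tsum_sph d lam fun u => (‖f (x - u)‖₊ : ℝ≥0∞)
  rw [tsum_eq_sum (s := cube d (Nat.sqrt lam)) fun u hu => by rw [rep_sub_eq_zero hu]; simp] at h1
  rw [← h1, tsum_fintype, avg0, tsum_fintype, nnnorm_mul, ENNReal.coe_mul, ← Ncount_eq_rep h]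
  refine mul_le_mul' ?_ ?_
  · rw [nnnorm_inv, ENNReal.coe_inv (by simpa using h.ne')]
    simp
  · exact_mod_cast nnnorm_sum_le _ _

lemma rep_zero_right (k : ℕ) : rep k 0 = 1 := by
  induction k with
  | zero => rfl
  | succ k ih => simp [rep, ih]

lemma two_mul_sqrt_add_one_le {n : ℕ} (hn : 1 ≤ n) : 2 * (Nat.sqrt n : ℝ) + 1 ≤ 3 * √(n : ℝ) := by
  have h1 : (Nat.sqrt n : ℝ) ≤ √(n : ℝ) := Real.nat_sqrt_le_real_sqrt
  have h2 : 1 ≤ √(n : ℝ) := Real.one_le_sqrt.2 (by exact_mod_cast hn)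
  linarith

lemma ennreal_natCast_mul_le {a b m : ℕ} {K : ℝ} (hK : 0 ≤ K) (h : (a * b : ℝ) ≤ K * m) :
    (a * b : ℝ≥0∞) ≤ K.toNNReal * m := by
  have h1 := ENNReal.ofReal_le_ofReal h
  rw [ENNReal.ofReal_mul (by positivity), ENNReal.ofReal_mul hK, ENNReal.ofReal_natCast,
    ENNReal.ofReal_natCast, ENNReal.ofReal_natCast] at h1
  exact h1

lemma exists_rep_mul_le (e : ℕ) : ∃ K : ℝ≥0, ∀ (n : ℕ) (u : Fin (e + 5) → ℤ),
    (rep (e + 5) (n - ∑ i, u i ^ 2) * (2 * Nat.sqrt n + 1) ^ (e + 5) : ℝ≥0∞)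
      ≤ K * rep (e + 5 + (e + 5)) n := by
  obtain ⟨C, hC, h1⟩ := exists_rep_le e
  obtain ⟨c, hc, h2⟩ := exists_le_rep (2 * e + 5)
  have hK : 0 ≤ C * 3 ^ (e + 5) / c + 1 := by positivity
  refine ⟨(C * 3 ^ (e + 5) / c + 1).toNNReal, fun n u => ?_⟩
  suffices h : ((rep (e + 5) (n - ∑ i, u i ^ 2) * ((2 * Nat.sqrt n + 1) ^ (e + 5) : ℕ)) : ℝ)
      ≤ (C * 3 ^ (e + 5) / c + 1) * rep (e + 5 + (e + 5)) n by
    exact_mod_cast ennreal_natCast_mul_le hK h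
  have hs : 0 ≤ ∑ i, u i ^ 2 := Finset.sum_nonneg fun _ _ => sq_nonneg _
  rcases lt_or_ge ((n : ℤ) - ∑ i, u i ^ 2) 0 with hneg | hpos
  · rw [rep_neg _ hneg, Nat.cast_zero, zero_mul]
    positivity
  rcases Nat.eq_zero_or_pos n with rfl | hn
  · have : ∑ i, u i ^ 2 = 0 := by push_cast at hpos; omega
    simp only [this, Nat.cast_zero, sub_zero, rep_zero_right]
    simp only [Nat.sqrt_zero, mul_zero, zero_add, one_pow, Nat.cast_one, mul_one]
    linarith [show 0 ≤ C * 3 ^ (e + 5) / c by positivity]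
  obtain ⟨m, hm⟩ := Int.eq_ofNat_of_zero_le hpos
  have h3 := h1 n m hn (by omega)
  have h4 := h2 n hn
  rw [show 2 * e + 5 + 5 = e + 5 + (e + 5) by ring] at h4
  rw [hm]
  push_cast
  calc (rep (e + 5) m : ℝ) * (2 * (Nat.sqrt n : ℝ) + 1) ^ (e + 5)
      ≤ (C * √(n : ℝ) ^ (e + 3)) * (3 * √(n : ℝ)) ^ (e + 5) := by
        gcongr
        exact two_mul_sqrt_add_one_le hn
    _ = C * 3 ^ (e + 5) / c * (c * √(n : ℝ) ^ (2 * e + 5 + 3)) := by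
        field_simp
        ring
    _ ≤ C * 3 ^ (e + 5) / c * rep (e + 5 + (e + 5)) n := by gcongr
    _ ≤ _ := by gcongr; linarith

lemma mul_sq_le_cube_add_cube {a b : ℝ} (ha : 0 ≤ a) (hb : 0 ≤ b) : a * b ^ 2 ≤ a ^ 3 + b ^ 3 := by
  rcases le_total a b with h | h
  · nlinarith [mul_le_mul_of_nonneg_right h (sq_nonneg b), pow_nonneg ha 3]
  · nlinarith [mul_le_mul_of_nonneg_left (pow_le_pow_left₀ hb h 2) ha, pow_nonneg hb 3]

lemma sum_cube_rep_sq_le (d n : ℕ) :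
    ∑ u ∈ cube d (Nat.sqrt n), rep d (n - ∑ i, u i ^ 2) ^ 2
      ≤ ∑ m ∈ Finset.range (n + 1), rep d m * rep d (n - m) ^ 2 := by
  classical
  have h : ∀ u ∈ cube d (Nat.sqrt n), rep d (n - ∑ i, u i ^ 2) ^ 2
      ≤ ∑ m ∈ Finset.range (n + 1), if ∑ i, u i ^ 2 = (m : ℤ) then rep d (n - m) ^ 2 else 0 := by
    intro u _
    have hs : 0 ≤ ∑ i, u i ^ 2 := Finset.sum_nonneg fun _ _ => sq_nonneg _
    obtain ⟨m, hm⟩ := Int.eq_ofNat_of_zero_le hs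
    rcases lt_or_ge n m with hnm | hnm
    · rw [hm, rep_neg _ (by omega)]
      simp
    · refine le_trans (le_of_eq ?_) (Finset.single_le_sum (f := fun m : ℕ =>
        if ∑ i, u i ^ 2 = (m : ℤ) then rep d (n - m) ^ 2 else 0)
        (fun _ _ => Nat.zero_le _) (Finset.mem_range.2 (Nat.lt_succ_of_le hnm)))
      simp only [hm, if_true]
  refine (Finset.sum_le_sum h).trans ?_
  rw [Finset.sum_comm]
  refine Finset.sum_le_sum fun m _ => ?_
  rw [← Finset.sum_filter, Finset.sum_const, smul_eq_mul]
  gcongr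
  exact card_le_rep _ fun v hv => (Finset.mem_filter.1 hv).2

lemma exists_sum_rep_sq_mul_le (e : ℕ) : ∃ K : ℝ≥0, ∀ n : ℕ,
    ((∑ u ∈ cube (e + 3) (Nat.sqrt n), (rep (e + 3) (n - ∑ i, u i ^ 2) : ℝ≥0∞) ^ 2) *
      (2 * Nat.sqrt n + 1) ^ (e + 3) : ℝ≥0∞) ≤ K * rep (e + 3 + (e + 3)) n ^ 2 := by
  obtain ⟨C, hC, h1⟩ := exists_sum_rep_cube_le e
  obtain ⟨c, hc, h2⟩ := exists_le_rep (2 * e + 1)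
  have hK : 0 ≤ 2 * C * 3 ^ (e + 3) / c ^ 2 + 1 := by positivity
  refine ⟨(2 * C * 3 ^ (e + 3) / c ^ 2 + 1).toNNReal, fun n => ?_⟩
  suffices h : (((∑ u ∈ cube (e + 3) (Nat.sqrt n), rep (e + 3) (n - ∑ i, u i ^ 2) ^ 2 : ℕ) *
      ((2 * Nat.sqrt n + 1) ^ (e + 3) : ℕ)) : ℝ)
      ≤ (2 * C * 3 ^ (e + 3) / c ^ 2 + 1) * (rep (e + 3 + (e + 3)) n ^ 2 : ℕ) by
    exact_mod_cast ennreal_natCast_mul_le hK h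
  have h0 : ((∑ u ∈ cube (e + 3) (Nat.sqrt n), rep (e + 3) (n - ∑ i, u i ^ 2) ^ 2 : ℕ) : ℝ)
      ≤ ∑ m ∈ Finset.range (n + 1), (rep (e + 3) m : ℝ) * rep (e + 3) (n - m) ^ 2 := by
    exact_mod_cast sum_cube_rep_sq_le (e + 3) n
  rcases Nat.eq_zero_or_pos n with rfl | hn
  · simp only [zero_add, Finset.sum_range_one, Nat.cast_zero, sub_zero, rep_zero_right] at h0 ⊢
    simp only [Nat.sqrt_zero, mul_zero, zero_add, one_pow, Nat.cast_one, mul_one] at h0 ⊢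
    linarith [show 0 ≤ 2 * C * 3 ^ (e + 3) / c ^ 2 by positivity]
  have h3 := h1 n hn
  have h4 := h2 n hn
  rw [show 2 * e + 1 + 5 = e + 3 + (e + 3) by ring] at h4
  have h5 : ∑ m ∈ Finset.range (n + 1), (rep (e + 3) m : ℝ) * rep (e + 3) (n - m) ^ 2
      ≤ 2 * (C * √(n : ℝ) ^ (3 * e + 5)) := by
    have h6 : ∑ m ∈ Finset.range (n + 1), (rep (e + 3) (n - m) : ℝ) ^ 3
        = ∑ m ∈ Finset.range (n + 1), (rep (e + 3) m : ℝ) ^ 3 := by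
      rw [← Finset.sum_range_reflect]
      refine Finset.sum_congr rfl fun m hm => ?_
      rw [Finset.mem_range] at hm
      congr 3
      omega
    refine (Finset.sum_le_sum fun m _ => mul_sq_le_cube_add_cube (Nat.cast_nonneg _)
      (Nat.cast_nonneg _)).trans ?_
    rw [Finset.sum_add_distrib, h6]
    linarith
  push_cast at h0 ⊢
  calc _ ≤ (2 * (C * √(n : ℝ) ^ (3 * e + 5))) * (3 * √(n : ℝ)) ^ (e + 3) := by
        gcongr
        · exact h0.trans h5
        · exact two_mul_sqrt_add_one_le hn
    _ = 2 * C * 3 ^ (e + 3) / c ^ 2 * (c * √(n : ℝ) ^ (2 * e + 1 + 3)) ^ 2 := by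
        field_simp
        ring
    _ ≤ 2 * C * 3 ^ (e + 3) / c ^ 2 * (rep (e + 3 + (e + 3)) n : ℝ) ^ 2 := by gcongr
    _ ≤ _ := by gcongr; linarith

lemma exists_maxOp0_le_of_five_le {d : ℕ} (hd : 5 ≤ d) : ∃ K : ℝ≥0, ∀ (f : V d → ℂ) (x : V d),
    maxOp0 d f x ≤ K * cubeMax (fun y => (‖f y‖₊ : ℝ≥0∞)) x := by
  obtain ⟨e, rfl⟩ := Nat.exists_eq_add_of_le' hd
  obtain ⟨K, hK⟩ := exists_rep_mul_le e
  refine ⟨K, fun f x => iSup₂_le fun n hn => (enorm_avg0_le hn f x).trans ?_⟩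
  have hr := Ncount_eq_rep hn
  have hr0 : (rep (e + 5 + (e + 5)) n : ℝ≥0∞) ≠ 0 := by
    rw [← hr]; exact_mod_cast hn.ne'
  set F : V (e + 5) → ℝ≥0∞ := fun y => (‖f y‖₊ : ℝ≥0∞)
  rw [ENNReal.inv_mul_le_iff hr0 (ENNReal.natCast_ne_top _)]
  set D : ℝ≥0∞ := (2 * Nat.sqrt n + 1) ^ (e + 5)
  have hD0 : D ≠ 0 := by positivity
  have hD : D ≠ ⊤ := by finiteness
  have h1 : ∀ u : Fin (e + 5) → ℤ, (rep (e + 5) (n - ∑ i, u i ^ 2) : ℝ≥0∞)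
      ≤ K * rep (e + 5 + (e + 5)) n / D := fun u => by
    rw [ENNReal.le_div_iff_mul_le (Or.inl hD0) (Or.inl hD)]
    exact hK n u
  calc ∑ u ∈ cube (e + 5) (Nat.sqrt n), rep (e + 5) (n - ∑ i, u i ^ 2) * F (x - u)
      ≤ ∑ u ∈ cube (e + 5) (Nat.sqrt n), K * rep (e + 5 + (e + 5)) n / D * F (x - u) := by
        gcongr with u; exact h1 u
    _ = K * rep (e + 5 + (e + 5)) n / D * ∑ u ∈ cube (e + 5) (Nat.sqrt n), F (x - u) := by
        rw [Finset.mul_sum]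
    _ ≤ K * rep (e + 5 + (e + 5)) n / D * (D * cubeMax F x) := by
        gcongr; exact sum_cube_le_cubeMax F x _
    _ = _ := by
        rw [← mul_assoc, ENNReal.div_mul_cancel hD0 hD]; ring

lemma exists_maxOp0_sq_le {d : ℕ} (hd : 3 ≤ d) : ∃ K : ℝ≥0, ∀ (f : V d → ℂ) (x : V d),
    maxOp0 d f x ^ (2 : ℝ) ≤ K * cubeMax (fun y => (‖f y‖₊ : ℝ≥0∞) ^ (2 : ℝ)) x := by
  obtain ⟨e, rfl⟩ := Nat.exists_eq_add_of_le' hd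
  obtain ⟨K, hK⟩ := exists_sum_rep_sq_mul_le e
  refine ⟨K, fun f x => ?_⟩
  rw [← ENNReal.le_rpow_inv_iff (by norm_num)]
  refine iSup₂_le fun n hn => (enorm_avg0_le hn f x).trans ?_
  rw [ENNReal.le_rpow_inv_iff (by norm_num)]
  have hr := Ncount_eq_rep hn
  have hr0 : (rep (e + 3 + (e + 3)) n : ℝ≥0∞) ≠ 0 := by
    rw [← hr]; exact_mod_cast hn.ne'
  set F : V (e + 3) → ℝ≥0∞ := fun y => (‖f y‖₊ : ℝ≥0∞)
  set R : ℝ≥0∞ := (rep (e + 3 + (e + 3)) n : ℝ≥0∞)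
  set D : ℝ≥0∞ := (2 * Nat.sqrt n + 1) ^ (e + 3)
  set s := cube (e + 3) (Nat.sqrt n)
  have hCS := ENNReal.inner_le_Lp_mul_Lq s
    (fun u => (rep (e + 3) (n - ∑ i, u i ^ 2) : ℝ≥0∞)) (fun u => F (x - u))
    (p := 2) (q := 2) (Real.HolderConjugate.two_two)
  have hCS2 := ENNReal.rpow_le_rpow hCS (show (0 : ℝ) ≤ 2 by norm_num)
  rw [← ENNReal.mul_rpow_of_nonneg _ _ (by norm_num), ← ENNReal.rpow_mul,
    show (1 / 2 : ℝ) * 2 = 1 by norm_num, ENNReal.rpow_one] at hCS2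
  rw [ENNReal.mul_rpow_of_nonneg _ _ (by norm_num), ENNReal.inv_rpow,
    ENNReal.inv_mul_le_iff (by simpa [R] using hr0) (by finiteness)]
  refine hCS2.trans ?_
  have h2 := hK n
  have h3 := sum_cube_le_cubeMax (fun y => F y ^ (2 : ℝ)) x (Nat.sqrt n)
  simp only [ENNReal.rpow_ofNat] at h3 ⊢
  calc _ ≤ (∑ u ∈ s, (rep (e + 3) (n - ∑ i, u i ^ 2) : ℝ≥0∞) ^ 2) *
          (D * cubeMax (fun y => F y ^ 2) x) := by gcongr
    _ = (∑ u ∈ s, (rep (e + 3) (n - ∑ i, u i ^ 2) : ℝ≥0∞) ^ 2) * D *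
          cubeMax (fun y => F y ^ 2) x := by ring
    _ ≤ K * R ^ 2 * cubeMax (fun y => F y ^ 2) x := by gcongr
    _ = _ := by ring

/-- A maximal operator whose power `r` is controlled by the Hardy-Littlewood maximal function of
`|f| ^ r` is bounded on `l^p` for `p > r`. -/
lemma exists_lpNormE_maxOp0_le {d : ℕ} (hd : d ≠ 0) {p r : ℝ} (hr : 0 < r) (hp : r < p) {K : ℝ≥0}
    (hK : ∀ (f : V d → ℂ) (x : V d),
      maxOp0 d f x ^ r ≤ K * cubeMax (fun y => (‖f y‖₊ : ℝ≥0∞) ^ r) x) :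
    ∃ C : ℝ≥0, ∀ f : V d → ℂ, lpNormE d p (maxOp0 d f) ≤ C * lpNorm d p f := by
  have hp0 : 0 < p := hr.trans hp
  obtain ⟨C, hC, h⟩ := exists_tsum_cubeMax_rpow_le hd ((one_lt_div hr).2 hp)
  have hfin : ((K : ℝ≥0∞) ^ (p / r) * C) ^ (1 / p) ≠ ⊤ := by
    have : 0 < p / r := by positivity
    have : 0 < 1 / p := by positivity
    finiteness
  refine ⟨(((K : ℝ≥0∞) ^ (p / r) * C) ^ (1 / p)).toNNReal, fun f => ?_⟩
  rw [ENNReal.coe_toNNReal hfin, lpNormE, lpNorm, ← ENNReal.mul_rpow_of_nonneg _ _ (by positivity)]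
  have hrp : r * (p / r) = p := by field_simp
  gcongr
  calc ∑' x, maxOp0 d f x ^ p
      = ∑' x, (maxOp0 d f x ^ r) ^ (p / r) := by simp_rw [← ENNReal.rpow_mul, hrp]
    _ ≤ ∑' x, (K * cubeMax (fun y => (‖f y‖₊ : ℝ≥0∞) ^ r) x) ^ (p / r) := by
        gcongr with x; exact hK f x
    _ = K ^ (p / r) * ∑' x, cubeMax (fun y => (‖f y‖₊ : ℝ≥0∞) ^ r) x ^ (p / r) := by
        rw [← ENNReal.tsum_mul_left]
        simp_rw [ENNReal.mul_rpow_of_nonneg _ _ (show 0 ≤ p / r by positivity)]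
    _ ≤ K ^ (p / r) * (C * ∑' x, ((‖f x‖₊ : ℝ≥0∞) ^ r) ^ (p / r)) := by
        gcongr; exact h _
    _ = _ := by simp_rw [← ENNReal.rpow_mul, hrp, mul_assoc]

/-- For `d ≥ 3` and `p > d/(d-2)`, the linearized maximal operator `T*₀` is
bounded on `l^p(ℤ^d)`. -/
theorem linearized_discrete_spherical_lp
    (d : ℕ) (hd : 3 ≤ d) (p : ℝ) (hp : (d : ℝ) / ((d : ℝ) - 2) < p) :
    ∃ C : ℝ≥0, ∀ f : V d → ℂ,
      lpNormE d p (maxOp0 d f) ≤ C * lpNorm d p f := by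
  rcases le_or_gt 5 d with h5 | h5
  · have hd5 : (5 : ℝ) ≤ d := by exact_mod_cast h5
    have hp1 : 1 < p := by
      rw [div_lt_iff₀ (by linarith)] at hp
      by_contra! hcon
      nlinarith
    obtain ⟨K, hK⟩ := exists_maxOp0_le_of_five_le h5
    exact exists_lpNormE_maxOp0_le (by omega) one_pos hp1 (by simpa using hK)
  · have hp2 : 2 < p := by
      interval_cases d <;> norm_num at hp <;> linarith
    obtain ⟨K, hK⟩ := exists_maxOp0_sq_le hd
    exact exists_lpNormE_maxOp0_le (by omega) two_pos hp2 hK
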